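/- arXiv:0911.1548 — 2 statements merged into one kernel-verified Lean document; each statement's English description precedes it below -/
import Mathlib

section
/- Assume Hypotheses (H). Fix θ ∈ (0,1), f ∈ C^{2+θ}_b(ℝ^N) and g ∈ C^{0,θ}([0,T]×ℝ^N). Let u be the unique bounded classical solution of D_t u = 𝒜u + g on [0,T]×ℝ^N with u(0,·)=f; let w be the unique bounded classical solution of the homogeneous problem D_t w = 𝒜w with w(0,·)=f; and for each r ∈ [0,T) let v^{(r)} be the unique bounded classical solution on [r,T]×ℝ^N of D_t v = 𝒜v with v(r,·) = g(r,·). Then the variation-of-constants formula holds: u(t,x) = w(t,x) + ∫_0^t v^{(r)}(t,x) dr for every t ∈ [0,T] and x ∈ ℝ^N. -/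
open Set Filter MeasureTheory Metric
open scoped Topology ENNReal RealInnerProductSpace Classical

noncomputable section

/-- `ℝ^N` with the Euclidean norm. -/
abbrev ES (N : ℕ) := EuclideanSpace ℝ (Fin N)

/-- First-order partial derivative `D_i f` in the `i`-th coordinate direction. -/
def pd1 {N : ℕ} (f : ES N → ℝ) (i : Fin N) : ES N → ℝ :=
  fun x => fderiv ℝ f x (EuclideanSpace.single i 1)

/-- Second-order partial derivative `D_{ij} f`. -/
def pd2 {N : ℕ} (f : ES N → ℝ) (i j : Fin N) : ES N → ℝ := pd1 (pd1 f j) i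

/-- Third-order partial derivative `D_{ijk} f`. -/
def pd3 {N : ℕ} (f : ES N → ℝ) (i j k : Fin N) : ES N → ℝ := pd1 (pd2 f j k) i

/-- The nonautonomous elliptic operator
`(𝒜 φ)(t,x) = ∑ᵢⱼ qᵢⱼ(t,x) Dᵢⱼφ(x) + ∑ⱼ bⱼ(t,x) Dⱼφ(x) + c(t,x) φ(x)`. -/
def Aop {N : ℕ} (q : ℝ → ES N → Fin N → Fin N → ℝ) (b : ℝ → ES N → Fin N → ℝ)
    (c : ℝ → ES N → ℝ) (φ : ES N → ℝ) (t : ℝ) (x : ES N) : ℝ :=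
  (∑ i, ∑ j, q t x i j * pd2 φ i j x) + (∑ j, b t x j * pd1 φ j x) + c t x * φ x

/-- Membership in the parabolic Hölder space `C^{δ/2,δ}([0,T] × B(0,R))`. -/
def ParabolicHolderOn {N : ℕ} (T δ R : ℝ) (h : ℝ → ES N → ℝ) : Prop :=
  ∃ C : ℝ, ∀ t ∈ Icc (0:ℝ) T, ∀ s ∈ Icc (0:ℝ) T,
    ∀ x ∈ closedBall (0 : ES N) R, ∀ y ∈ closedBall (0 : ES N) R,
      |h t x - h s y| ≤ C * (|t - s| + ‖x - y‖ ^ 2) ^ (δ / 2)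

/-- Hypotheses (H) of Lorenzi's paper (smooth unbounded coefficients). -/
structure Hyp (N : ℕ) (T : ℝ) (q : ℝ → ES N → Fin N → Fin N → ℝ)
    (b : ℝ → ES N → Fin N → ℝ) (c : ℝ → ES N → ℝ) where
  T_pos : 0 < T
  N_pos : 1 ≤ N
  /- (i) smoothness in space and parabolic Hölder regularity up to third-order
     spatial derivatives on `[0,T] × B(0,R)` for every `R`. -/
  δ : ℝ
  δ_mem : δ ∈ Ioo (0:ℝ) 1
  smooth_q : ∀ t ∈ Icc (0:ℝ) T, ∀ i j, ContDiff ℝ 3 fun x => q t x i j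
  smooth_b : ∀ t ∈ Icc (0:ℝ) T, ∀ j, ContDiff ℝ 3 fun x => b t x j
  smooth_c : ∀ t ∈ Icc (0:ℝ) T, ContDiff ℝ 3 fun x => c t x
  holder_q : ∀ R > 0, ∀ i j, ParabolicHolderOn T δ R fun t x => q t x i j
  holder_q1 : ∀ R > 0, ∀ i j k, ParabolicHolderOn T δ R fun t x => pd1 (fun y => q t y i j) k x
  holder_q2 : ∀ R > 0, ∀ i j k l, ParabolicHolderOn T δ R fun t x => pd2 (fun y => q t y i j) k l x
  holder_q3 : ∀ R > 0, ∀ i j k l m, ParabolicHolderOn T δ R fun t x => pd3 (fun y => q t y i j) k l m x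
  holder_b : ∀ R > 0, ∀ j, ParabolicHolderOn T δ R fun t x => b t x j
  holder_b1 : ∀ R > 0, ∀ j k, ParabolicHolderOn T δ R fun t x => pd1 (fun y => b t y j) k x
  holder_b2 : ∀ R > 0, ∀ j k l, ParabolicHolderOn T δ R fun t x => pd2 (fun y => b t y j) k l x
  holder_b3 : ∀ R > 0, ∀ j k l m, ParabolicHolderOn T δ R fun t x => pd3 (fun y => b t y j) k l m x
  holder_c : ∀ R > 0, ParabolicHolderOn T δ R c
  holder_c1 : ∀ R > 0, ∀ k, ParabolicHolderOn T δ R fun t x => pd1 (c t) k x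
  holder_c2 : ∀ R > 0, ∀ k l, ParabolicHolderOn T δ R fun t x => pd2 (c t) k l x
  holder_c3 : ∀ R > 0, ∀ k l m, ParabolicHolderOn T δ R fun t x => pd3 (c t) k l m x
  /- (ii) symmetry and (uniform) ellipticity. -/
  q_symm : ∀ t ∈ Icc (0:ℝ) T, ∀ x i j, q t x i j = q t x j i
  ν : ℝ → ES N → ℝ
  ν₀ : ℝ
  ν₀_pos : 0 < ν₀
  ν_lb : ∀ t ∈ Icc (0:ℝ) T, ∀ x, ν₀ ≤ ν t x
  ellip : ∀ t ∈ Icc (0:ℝ) T, ∀ x, ∀ ξ : ES N, ν t x * ‖ξ‖ ^ 2 ≤ ∑ i, ∑ j, q t x i j * ξ i * ξ j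
  /- (iii) growth conditions. -/
  C₁ : ℝ
  C₂ : ℝ
  C₃ : ℝ
  C₁_pos : 0 < C₁
  C₂_pos : 0 < C₂
  C₃_pos : 0 < C₃
  growth_Q : ∀ t ∈ Icc (0:ℝ) T, ∀ x,
    ‖(EuclideanSpace.equiv (Fin N) ℝ).symm fun i => ∑ j, q t x i j * x j‖
      ≤ C₁ * (1 + ‖x‖ ^ 2) * ν t x
  growth_tr : ∀ t ∈ Icc (0:ℝ) T, ∀ x, (∑ i, q t x i i) ≤ C₂ * (1 + ‖x‖ ^ 2) * ν t x
  growth_b : ∀ t ∈ Icc (0:ℝ) T, ∀ x, (∑ j, b t x j * x j) ≤ C₃ * (1 + ‖x‖ ^ 2) * ν t x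
  /- (iv) `c` is bounded from above. -/
  c₀ : ℝ
  c_ub : ∀ t ∈ Icc (0:ℝ) T, ∀ x, c t x ≤ c₀
  /- (v) bounds on the derivatives of the diffusion coefficients. -/
  K₁ : ℝ
  K₂ : ℝ
  K₃ : ℝ
  K₁_pos : 0 < K₁
  K₂_pos : 0 < K₂
  K₃_pos : 0 < K₃
  dq1_bound : ∀ t ∈ Icc (0:ℝ) T, ∀ x i j k, |pd1 (fun y => q t y i j) k x| ≤ K₁ * ν t x
  dq3_bound : ∀ t ∈ Icc (0:ℝ) T, ∀ x i j k l m, |pd3 (fun y => q t y i j) k l m x| ≤ K₃ * ν t x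
  dq2_quad : ∀ t ∈ Icc (0:ℝ) T, ∀ x, ∀ Ξ : Fin N → Fin N → ℝ, (∀ h k, Ξ h k = Ξ k h) →
    (∑ h, ∑ k, ∑ l, ∑ m, pd2 (fun y => q t y h k) l m x * Ξ h k * Ξ l m)
      ≤ K₂ * ν t x * ∑ h, ∑ k, Ξ h k ^ 2
  /- (vi) dissipativity and bounds on the derivatives of the drift and of `c`. -/
  d : ℝ → ES N → ℝ
  r : ℝ → ES N → ℝ
  ϱ : ℝ → ES N → ℝ
  ϱ₀ : ℝ
  ϱ₀_pos : 0 < ϱ₀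
  ϱ_lb : ∀ t ∈ Icc (0:ℝ) T, ∀ x, ϱ₀ ≤ ϱ t x
  L₁ : ℝ
  L₂ : ℝ
  L₃ : ℝ
  L₁_pos : 0 < L₁
  L₂_pos : 0 < L₂
  L₃_pos : 0 < L₃
  dissip : ∀ t ∈ Icc (0:ℝ) T, ∀ x, ∀ ξ : ES N,
    (∑ i, ∑ j, pd1 (fun y => b t y i) j x * ξ j * ξ i) ≤ d t x * ‖ξ‖ ^ 2
  db2_bound : ∀ t ∈ Icc (0:ℝ) T, ∀ x j k l, |pd2 (fun y => b t y j) k l x| ≤ r t x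
  db3_bound : ∀ t ∈ Icc (0:ℝ) T, ∀ x j k l m, |pd3 (fun y => b t y j) k l m x| ≤ r t x
  dc1_bound : ∀ t ∈ Icc (0:ℝ) T, ∀ x k, |pd1 (c t) k x| ≤ ϱ t x
  dc2_bound : ∀ t ∈ Icc (0:ℝ) T, ∀ x k l, |pd2 (c t) k l x| ≤ ϱ t x
  dc3_bound : ∀ t ∈ Icc (0:ℝ) T, ∀ x k l m, |pd3 (c t) k l m x| ≤ ϱ t x
  funz : ∀ t ∈ Icc (0:ℝ) T, ∀ x, d t x + L₁ * r t x + L₂ * ϱ t x ^ 2 ≤ L₃ * ν t x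
  /- (vii) existence of a Lyapunov function. -/
  liap : ∃ φ : ES N → ℝ, ∃ lam : ℝ, 0 < lam ∧ (∀ x, 0 < φ x) ∧ ContDiff ℝ 2 φ ∧
    Tendsto φ (cocompact (ES N)) atTop ∧
    ∃ M : ℝ, ∀ t ∈ Icc (0:ℝ) T, ∀ x, Aop q b c φ t x - lam * φ x ≤ M

/-- `u` is a bounded classical solution on `[s,τ] × ℝ^N` of the homogeneous Cauchy problem
`D_t u = 𝒜 u`, `u(s,·) = f`: it is bounded and continuous on `[s,τ] × ℝ^N`, continuously
differentiable once in time and twice in space on `(s,τ] × ℝ^N`, satisfies the equation there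
and attains the initial datum `f` at time `s`. -/
def IsBCSol {N : ℕ} (q : ℝ → ES N → Fin N → Fin N → ℝ) (b : ℝ → ES N → Fin N → ℝ)
    (c : ℝ → ES N → ℝ) (s τ : ℝ) (f : ES N → ℝ) (u : ℝ → ES N → ℝ) : Prop :=
  (∃ M, ∀ t ∈ Icc s τ, ∀ x, |u t x| ≤ M) ∧
  ContinuousOn (fun p : ℝ × ES N => u p.1 p.2) (Icc s τ ×ˢ univ) ∧
  (∀ t ∈ Ioc s τ, ContDiff ℝ 2 (u t)) ∧
  (∀ x, ∀ t ∈ Ioc s τ, DifferentiableAt ℝ (fun t' => u t' x) t) ∧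
  ContinuousOn (fun p : ℝ × ES N => deriv (fun t' => u t' p.2) p.1) (Ioc s τ ×ˢ univ) ∧
  (∀ i, ContinuousOn (fun p : ℝ × ES N => pd1 (u p.1) i p.2) (Ioc s τ ×ˢ univ)) ∧
  (∀ i j, ContinuousOn (fun p : ℝ × ES N => pd2 (u p.1) i j p.2) (Ioc s τ ×ˢ univ)) ∧
  (∀ t ∈ Ioc s τ, ∀ x, deriv (fun t' => u t' x) t = Aop q b c (u t) t x) ∧
  (∀ x, u s x = f x)

/-- `u` is a bounded classical solution on `[0,T] × ℝ^N` of the nonhomogeneous Cauchy problem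
`D_t u = 𝒜 u + g`, `u(0,·) = f`, continuously differentiable once in time and twice in space
on all of `[0,T] × ℝ^N`. -/
def IsBCSolInhom {N : ℕ} (q : ℝ → ES N → Fin N → Fin N → ℝ) (b : ℝ → ES N → Fin N → ℝ)
    (c : ℝ → ES N → ℝ) (T : ℝ) (f : ES N → ℝ) (g : ℝ → ES N → ℝ) (u : ℝ → ES N → ℝ) : Prop :=
  (∃ M, ∀ t ∈ Icc (0:ℝ) T, ∀ x, |u t x| ≤ M) ∧
  (∀ t ∈ Icc (0:ℝ) T, ContDiff ℝ 2 (u t)) ∧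
  (∀ x, ∀ t ∈ Icc (0:ℝ) T, DifferentiableWithinAt ℝ (fun t' => u t' x) (Icc (0:ℝ) T) t) ∧
  ContinuousOn (fun p : ℝ × ES N => derivWithin (fun t' => u t' p.2) (Icc (0:ℝ) T) p.1)
    (Icc (0:ℝ) T ×ˢ univ) ∧
  (∀ i, ContinuousOn (fun p : ℝ × ES N => pd1 (u p.1) i p.2) (Icc (0:ℝ) T ×ˢ univ)) ∧
  (∀ i j, ContinuousOn (fun p : ℝ × ES N => pd2 (u p.1) i j p.2) (Icc (0:ℝ) T ×ˢ univ)) ∧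
  (∀ t ∈ Icc (0:ℝ) T, ∀ x,
    derivWithin (fun t' => u t' x) (Icc (0:ℝ) T) t = Aop q b c (u t) t x + g t x) ∧
  (∀ x, u 0 x = f x)

/-- Extended-real sup norm of the `k`-th derivative. -/
def supNormE {N : ℕ} (k : ℕ) (f : ES N → ℝ) : ℝ≥0∞ :=
  ⨆ x : ES N, ENNReal.ofReal ‖iteratedFDeriv ℝ k f x‖

/-- Extended-real `γ`-Hölder seminorm of the `k`-th derivative. -/
def holderSemiE {N : ℕ} (k : ℕ) (γ : ℝ) (f : ES N → ℝ) : ℝ≥0∞ :=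
  ⨆ (x : ES N) (y : ES N) (_ : x ≠ y),
    ENNReal.ofReal (‖iteratedFDeriv ℝ k f x - iteratedFDeriv ℝ k f y‖ / ‖x - y‖ ^ γ)

/-- The `C^α_b(ℝ^N)` norm (valued in `[0,∞]`): sup norms of the derivatives up to order `⌊α⌋`
plus, when `α ∉ ℕ`, the `(α-⌊α⌋)`-Hölder seminorm of the `⌊α⌋`-th order derivatives. -/
def CbNorm {N : ℕ} (α : ℝ) (f : ES N → ℝ) : ℝ≥0∞ :=
  (∑ k ∈ Finset.range (⌊α⌋₊ + 1), supNormE k f) +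
    (if (⌊α⌋₊ : ℝ) = α then 0 else holderSemiE ⌊α⌋₊ (α - ⌊α⌋₊) f)

/-- Membership in `C^α_b(ℝ^N)`. -/
def MemCb {N : ℕ} (α : ℝ) (f : ES N → ℝ) : Prop :=
  ContDiff ℝ (⌊α⌋₊ : ℕ) f ∧ CbNorm α f ≠ ⊤

section PartialDerivatives

variable {N : ℕ} {φ ψ : ES N → ℝ}

lemma pd1_comb (hφ : Differentiable ℝ φ) (hψ : Differentiable ℝ ψ) (a e : ℝ) (i : Fin N) :
    pd1 (fun x => a * φ x + e * ψ x) i = fun x => a * pd1 φ i x + e * pd1 ψ i x := by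
  funext x
  have h := ((hφ x).hasFDerivAt.const_mul a).add ((hψ x).hasFDerivAt.const_mul e)
  simp only [pd1]
  rw [HasFDerivAt.fderiv (f := fun x => a * φ x + e * ψ x) h]
  simp

lemma contDiff_pd1 {n m : ℕ} (hφ : ContDiff ℝ n φ) (hmn : m + 1 ≤ n) (i : Fin N) :
    ContDiff ℝ m (pd1 φ i) :=
  (hφ.fderiv_right (m := m) (by exact_mod_cast hmn)).clm_apply contDiff_const

lemma pd2_comb (hφ : ContDiff ℝ 2 φ) (hψ : ContDiff ℝ 2 ψ) (a e : ℝ) (i j : Fin N) :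
    pd2 (fun x => a * φ x + e * ψ x) i j = fun x => a * pd2 φ i j x + e * pd2 ψ i j x := by
  unfold pd2
  rw [pd1_comb (hφ.differentiable two_ne_zero) (hψ.differentiable two_ne_zero), pd1_comb]
  · exact (contDiff_pd1 (n := 2) (m := 1) hφ le_rfl j).differentiable (by simp)
  · exact (contDiff_pd1 (n := 2) (m := 1) hψ le_rfl j).differentiable (by simp)

lemma pd1_const (k : ℝ) (i : Fin N) : pd1 (fun _ : ES N => k) i = fun _ => 0 := by
  funext x; simp [pd1]

lemma pd2_const (k : ℝ) (i j : Fin N) : pd2 (fun _ : ES N => k) i j = fun _ => 0 := by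
  unfold pd2; rw [pd1_const, pd1_const]

lemma Aop_comb (q : ℝ → ES N → Fin N → Fin N → ℝ) (b : ℝ → ES N → Fin N → ℝ)
    (c : ℝ → ES N → ℝ) (hφ : ContDiff ℝ 2 φ) (hψ : ContDiff ℝ 2 ψ) (a e t : ℝ) (x : ES N) :
    Aop q b c (fun x => a * φ x + e * ψ x) t x = a * Aop q b c φ t x + e * Aop q b c ψ t x := by
  simp only [Aop, pd2_comb hφ hψ,
    pd1_comb (hφ.differentiable two_ne_zero) (hψ.differentiable two_ne_zero)]
  simp only [mul_add, Finset.sum_add_distrib, Finset.mul_sum]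
  have h1 : ∀ (s : ℝ) (χ : ES N → ℝ), ∑ i, ∑ j, q t x i j * (s * pd2 χ i j x)
      = ∑ i, ∑ j, s * (q t x i j * pd2 χ i j x) := fun s χ =>
    Finset.sum_congr rfl fun _ _ => Finset.sum_congr rfl fun _ _ => by ring
  have h2 : ∀ (s : ℝ) (χ : ES N → ℝ), ∑ j, b t x j * (s * pd1 χ j x)
      = ∑ j, s * (b t x j * pd1 χ j x) := fun s χ =>
    Finset.sum_congr rfl fun _ _ => by ring
  rw [h1, h1, h2, h2]
  ring

lemma Aop_const (q : ℝ → ES N → Fin N → Fin N → ℝ) (b : ℝ → ES N → Fin N → ℝ)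
    (c : ℝ → ES N → ℝ) (k t : ℝ) (x : ES N) :
    Aop q b c (fun _ => k) t x = c t x * k := by
  simp [Aop, pd1_const, pd2_const]

lemma sum_smul_single (ξ : ES N) : ξ = ∑ i, ξ i • EuclideanSpace.single i (1 : ℝ) := by
  ext j
  simp [Finset.sum_apply, Pi.single_apply]

lemma pd2_eq_fderiv_fderiv (hφ : ContDiff ℝ 2 φ) (x : ES N) (i j : Fin N) :
    pd2 φ i j x = fderiv ℝ (fderiv ℝ φ) x (EuclideanSpace.single i 1)
      (EuclideanSpace.single j 1) := by
  have hd : DifferentiableAt ℝ (fderiv ℝ φ) x :=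
    (hφ.fderiv_right (m := 1) (by norm_num)).differentiable one_ne_zero x
  have h := hd.hasFDerivAt.clm_apply (hasFDerivAt_const (EuclideanSpace.single j (1:ℝ)) x)
  unfold pd2
  rw [pd1, show pd1 φ j = fun y => fderiv ℝ φ y (EuclideanSpace.single j 1) from rfl, h.fderiv]
  simp

/-- The Hessian is negative semidefinite at a local maximum. -/
lemma sum_pd2_nonpos_of_isLocalMax (hφ : ContDiff ℝ 2 φ) {x : ES N} (hx : IsLocalMax φ x)
    (ξ : ES N) : ∑ i, ∑ j, ξ i * ξ j * pd2 φ i j x ≤ 0 := by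
  have hsum : ∑ i, ∑ j, ξ i * ξ j * pd2 φ i j x = fderiv ℝ (fderiv ℝ φ) x ξ ξ := by
    conv_rhs => rw [sum_smul_single ξ]
    simp only [map_sum, sum_apply, map_smul, smul_eq_mul,
      smul_apply, Finset.mul_sum, pd2_eq_fderiv_fderiv hφ]
    rw [Finset.sum_comm]
    exact Finset.sum_congr rfl fun _ _ => Finset.sum_congr rfl fun _ _ => by ring
  rw [hsum]
  have hline : ∀ r : ℝ, HasDerivAt (fun r : ℝ => x + r • ξ) ξ r := fun r => by
    simpa using ((hasDerivAt_id r).smul_const ξ).const_add x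
  have hd1 : ∀ r : ℝ, HasDerivAt (fun r : ℝ => φ (x + r • ξ)) (fderiv ℝ φ (x + r • ξ) ξ) r :=
    fun r => ((hφ.differentiable two_ne_zero) _).hasFDerivAt.comp_hasDerivAt r (hline r)
  have hD : deriv (fun r : ℝ => φ (x + r • ξ)) = fun r => fderiv ℝ φ (x + r • ξ) ξ :=
    funext fun r => (hd1 r).deriv
  have hd2 : HasDerivAt (fun r : ℝ => fderiv ℝ φ (x + r • ξ) ξ)
      (fderiv ℝ (fderiv ℝ φ) x ξ ξ) 0 := by
    have hdd : HasFDerivAt (fderiv ℝ φ) (fderiv ℝ (fderiv ℝ φ) x) (x + (0 : ℝ) • ξ) := by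
      rw [zero_smul, add_zero]
      exact ((hφ.fderiv_right (m := 1) (by norm_num)).differentiable one_ne_zero x).hasFDerivAt
    have h : HasDerivAt (fun r : ℝ => fderiv ℝ φ (x + r • ξ)) (fderiv ℝ (fderiv ℝ φ) x ξ) 0 :=
      hdd.comp_hasDerivAt (0 : ℝ) (hline 0)
    simpa using h.clm_apply (hasDerivAt_const (0 : ℝ) ξ)
  have hmax : IsLocalMax (fun r : ℝ => φ (x + r • ξ)) 0 := by
    have hc : ContinuousAt (fun r : ℝ => x + r • ξ) 0 := (hline 0).continuousAt
    have h0 : Tendsto (fun r : ℝ => x + r • ξ) (𝓝 0) (𝓝 x) := by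
      simpa [ContinuousAt] using hc
    filter_upwards [h0.eventually hx] with r hr
    simpa using hr
  by_contra! hpos
  have hmin : IsLocalMin (fun r : ℝ => φ (x + r • ξ)) 0 := by
    refine isLocalMin_of_deriv_deriv_pos ?_ ?_ (hd1 0).continuousAt
    · rw [hD, hd2.deriv]; exact hpos
    · exact hmax.deriv_eq_zero
  have hconst : (fun r : ℝ => φ (x + r • ξ)) =ᶠ[𝓝 0] fun _ => φ (x + (0 : ℝ) • ξ) := by
    filter_upwards [hmax, hmin] with r h1 h2
    exact le_antisymm h1 h2
  have h2 := hconst.deriv.deriv_eq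
  rw [hD, hd2.deriv] at h2
  simp at h2
  exact hpos.ne' h2

lemma sum_mul_pd2_nonpos_of_isLocalMax (hφ : ContDiff ℝ 2 φ) {x : ES N} (hx : IsLocalMax φ x)
    {A : Matrix (Fin N) (Fin N) ℝ} (hA : A.PosSemidef) :
    ∑ i, ∑ j, A i j * pd2 φ i j x ≤ 0 := by
  obtain ⟨S, rfl⟩ : ∃ S : Matrix (Fin N) (Fin N) ℝ, A = S.conjTranspose * S := by
    open scoped MatrixOrder in
    exact CStarAlgebra.nonneg_iff_eq_star_mul_self.mp hA.nonneg
  have h : ∑ i, ∑ j, (S.conjTranspose * S) i j * pd2 φ i j x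
      = ∑ k, ∑ i, ∑ j, S k i * S k j * pd2 φ i j x := by
    simp only [Matrix.mul_apply, Matrix.conjTranspose_apply, star_trivial, Finset.sum_mul]
    conv_rhs => rw [Finset.sum_comm]
    refine Finset.sum_congr rfl fun i _ => ?_
    rw [Finset.sum_comm]
  rw [h]
  refine Finset.sum_nonpos fun k _ => ?_
  simpa using sum_pd2_nonpos_of_isLocalMax hφ hx (WithLp.toLp 2 (S k))

end PartialDerivatives

/-- `y` is a bounded continuous function on `[s,τ] × ℝ^N` with `D_t y = 𝒜 y + F` on
`(s,τ] × ℝ^N`, the time derivative being one-sided at `τ`. -/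
structure IsSol {N : ℕ} (q : ℝ → ES N → Fin N → Fin N → ℝ) (b : ℝ → ES N → Fin N → ℝ)
    (c : ℝ → ES N → ℝ) (s τ : ℝ) (F y : ℝ → ES N → ℝ) : Prop where
  bounded : ∃ M, ∀ t ∈ Icc s τ, ∀ x, |y t x| ≤ M
  continuousOn : ContinuousOn (fun p : ℝ × ES N => y p.1 p.2) (Icc s τ ×ˢ univ)
  contDiff : ∀ t ∈ Ioc s τ, ContDiff ℝ 2 (y t)
  hasDeriv : ∀ t ∈ Ioc s τ, ∀ x,
    HasDerivWithinAt (fun t' => y t' x) (Aop q b c (y t) t x + F t x) (Icc s τ) t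

/-- A time-independent Lyapunov function `B ≥ 1` with `𝒜 B ≤ μ B`. -/
structure IsBarrier {N : ℕ} (q : ℝ → ES N → Fin N → Fin N → ℝ) (b : ℝ → ES N → Fin N → ℝ)
    (c : ℝ → ES N → ℝ) (T μ : ℝ) (B : ES N → ℝ) : Prop where
  nonneg : 0 ≤ μ
  one_le : ∀ x, 1 ≤ B x
  contDiff : ContDiff ℝ 2 B
  tendsto : Tendsto B (cocompact (ES N)) atTop
  Aop_le : ∀ t ∈ Icc (0 : ℝ) T, ∀ x, Aop q b c B t x ≤ μ * B x

section MaximumPrinciple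

variable {N : ℕ} {T : ℝ} {q : ℝ → ES N → Fin N → Fin N → ℝ}
  {b : ℝ → ES N → Fin N → ℝ} {c : ℝ → ES N → ℝ}

lemma Hyp.exists_isBarrier (H : Hyp N T q b c) : ∃ μ B, IsBarrier q b c T μ B := by
  obtain ⟨φ, lam, hlam, hpos, hC, htend, M, hM⟩ := H.liap
  refine ⟨lam + |M| + |H.c₀|, fun x => 1 * φ x + 1 * (fun _ => 1) x, by positivity,
    fun x => by linarith [hpos x], ?_, ?_, fun t ht x => ?_⟩
  · exact (contDiff_const.mul hC).add (contDiff_const.mul contDiff_const)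
  · simpa using tendsto_atTop_add_const_right _ 1 htend
  · rw [Aop_comb q b c hC contDiff_const, Aop_const]
    have h1 := hM t ht x
    have h2 := H.c_ub t ht x
    have h3 := le_abs_self M
    have h4 := le_abs_self H.c₀
    have h5 := mul_nonneg (add_nonneg (abs_nonneg M) (abs_nonneg H.c₀)) (hpos x).le
    linarith

namespace IsSol

variable {s τ : ℝ} {F F₁ F₂ y y₁ y₂ : ℝ → ES N → ℝ}

lemma mono (h : IsSol q b c s τ F y) {s' τ' : ℝ} (hs : s ≤ s') (hτ : τ' ≤ τ) :
    IsSol q b c s' τ' F y where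
  bounded := h.bounded.imp fun _ hM t ht => hM t (Icc_subset_Icc hs hτ ht)
  continuousOn := h.continuousOn.mono (prod_mono (Icc_subset_Icc hs hτ) le_rfl)
  contDiff t ht := h.contDiff t (Ioc_subset_Ioc hs hτ ht)
  hasDeriv t ht x := (h.hasDeriv t (Ioc_subset_Ioc hs hτ ht) x).mono (Icc_subset_Icc hs hτ)

lemma comb (h₁ : IsSol q b c s τ F₁ y₁) (h₂ : IsSol q b c s τ F₂ y₂) (a α β : ℝ) :
    IsSol q b c s τ (fun t x => a * F₁ t x + (α + β * t) * F₂ t x + β * y₂ t x)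
      (fun t x => a * y₁ t x + (α + β * t) * y₂ t x) where
  bounded := by
    obtain ⟨M₁, hM₁⟩ := h₁.bounded
    obtain ⟨M₂, hM₂⟩ := h₂.bounded
    obtain ⟨M₃, hM₃⟩ := isCompact_Icc.exists_bound_of_continuousOn
      (f := fun t : ℝ => α + β * t) (s := Icc s τ) (by fun_prop)
    refine ⟨|a| * M₁ + M₃ * M₂, fun t ht x => (abs_add_le _ _).trans ?_⟩
    rw [abs_mul, abs_mul]
    have h3 : |α + β * t| ≤ M₃ := hM₃ t ht
    gcongr
    · exact hM₁ t ht x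
    · exact (abs_nonneg _).trans h3
    · exact hM₂ t ht x
  continuousOn :=
    (continuousOn_const.mul h₁.continuousOn).add
      (ContinuousOn.mul (by fun_prop) h₂.continuousOn)
  contDiff t ht :=
    (contDiff_const.mul (h₁.contDiff t ht)).add (contDiff_const.mul (h₂.contDiff t ht))
  hasDeriv t ht x := by
    rw [Aop_comb q b c (h₁.contDiff t ht) (h₂.contDiff t ht)]
    have hlin : HasDerivWithinAt (fun t : ℝ => α + β * t) β (Icc s τ) t := by
      simpa using (((hasDerivAt_id t).const_mul β).const_add α).hasDerivWithinAt
    have h := ((h₁.hasDeriv t ht x).const_mul a).add (hlin.mul (h₂.hasDeriv t ht x))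
    exact h.congr_deriv (by ring)

/-- The maximum principle, with a Lyapunov function as weight. -/
lemma le_barrier (H : Hyp N T q b c) {μ : ℝ} {B : ES N → ℝ} (hB : IsBarrier q b c T μ B)
    (h : IsSol q b c s τ F y) (hs : 0 ≤ s) (hτ : τ ≤ T) {A K : ℝ} (hA : 0 ≤ A) (hK : 0 ≤ K)
    (hinit : ∀ x, y s x ≤ A * B x) (hF : ∀ t ∈ Ioc s τ, ∀ x, F t x ≤ K * B x) :
    ∀ t ∈ Icc s τ, ∀ x, y t x ≤ (A + K * (t - s)) * Real.exp (μ * (t - s)) * B x := by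
  have hBpos : ∀ x, 0 < B x := fun x => one_pos.trans_le (hB.one_le x)
  have key : ∀ ε > 0, ∀ t ∈ Icc s τ, ∀ x,
      y t x < (A + K * (t - s) + ε * (1 + (t - s))) * Real.exp (μ * (t - s)) * B x := by
    intro ε hε t₁ ht₁ x₁
    by_contra! hcon
    set k : ℝ → ℝ := fun t => (A + K * (t - s) + ε * (1 + (t - s))) * Real.exp (μ * (t - s))
      with hk
    have hkε : ∀ t ∈ Icc s τ, ε ≤ k t := by
      intro t ht
      have h0 : 0 ≤ t - s := sub_nonneg.2 ht.1
      have h1 : 1 ≤ Real.exp (μ * (t - s)) := Real.one_le_exp (mul_nonneg hB.nonneg h0)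
      have h2 : ε ≤ A + K * (t - s) + ε * (1 + (t - s)) := by
        nlinarith [mul_nonneg hK h0, mul_nonneg hε.le h0]
      exact h2.trans (le_mul_of_one_le_right (hε.le.trans h2) h1)
    have hkc : Continuous k := by fun_prop
    have hkd : ∀ t, HasDerivAt k
        ((K + ε) * Real.exp (μ * (t - s)) + μ * k t) t := by
      intro t
      have hid : HasDerivAt (fun t => t - s) 1 t := (hasDerivAt_id t).sub_const s
      have := (((hid.const_mul K).const_add A).add ((hid.const_add 1).const_mul ε)).mul
        ((hid.const_mul μ).exp)
      exact this.congr_deriv (by simp only [hk, Pi.add_apply]; ring)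
    set W : ℝ → ES N → ℝ := fun t x => 1 * y t x + (-k t) * B x with hW
    obtain ⟨M, hM⟩ := h.bounded
    obtain ⟨S, hS, hSW⟩ : ∃ S : Set (ES N), IsCompact S ∧ ∀ t ∈ Icc s τ, ∀ x ∉ S, W t x < 0 := by
      have hev := hB.tendsto.eventually_gt_atTop (M / ε)
      obtain ⟨S, hS, hSsub⟩ := mem_cocompact.1 hev
      refine ⟨S, hS, fun t ht x hx => ?_⟩
      have h1 : M / ε < B x := hSsub hx
      rw [div_lt_iff₀ hε] at h1
      have h2 := (le_abs_self _).trans (hM t ht x)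
      have h3 := mul_le_mul_of_nonneg_right (hkε t ht) (hBpos x).le
      simp only [hW]; linarith
    have hW₁ : 0 ≤ W t₁ x₁ := by simp only [hW, hk]; linarith
    have hx₁ : x₁ ∈ S := by
      by_contra hx
      exact (hSW t₁ ht₁ x₁ hx).not_ge hW₁
    have hcont : ContinuousOn (fun p : ℝ × ES N => Real.exp (-H.c₀ * p.1) * W p.1 p.2)
        (Icc s τ ×ˢ S) := by
      refine ContinuousOn.mul (by fun_prop) (ContinuousOn.add (continuousOn_const.mul
        (h.continuousOn.mono (prod_mono le_rfl (subset_univ _)))) ?_)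
      exact ((hkc.comp continuous_fst).neg.mul
        (hB.contDiff.continuous.comp continuous_snd)).continuousOn
    obtain ⟨⟨t₀, x₀⟩, ⟨ht₀, hx₀⟩, hmax⟩ :=
      (isCompact_Icc.prod hS).exists_isMaxOn ⟨(t₁, x₁), ht₁, hx₁⟩ hcont
    simp only at ht₀ hx₀
    have hW₀ : 0 ≤ W t₀ x₀ := by
      have h1 : Real.exp (-H.c₀ * t₁) * W t₁ x₁ ≤ Real.exp (-H.c₀ * t₀) * W t₀ x₀ :=
        hmax (a := (t₁, x₁)) ⟨ht₁, hx₁⟩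
      exact nonneg_of_mul_nonneg_right ((mul_nonneg (Real.exp_pos _).le hW₁).trans h1)
        (Real.exp_pos _)
    have hst₀ : s < t₀ := by
      refine lt_of_le_of_ne ht₀.1 fun heq => hW₀.not_gt ?_
      rw [← heq]
      have h1 := hinit x₀
      have h2 := mul_pos hε (hBpos x₀)
      simp only [hW, hk, sub_self, mul_zero, Real.exp_zero]
      linarith
    have ht₀' : t₀ ∈ Ioc s τ := ⟨hst₀, ht₀.2⟩
    have htT : t₀ ∈ Icc 0 T := ⟨hs.trans ht₀.1, ht₀.2.trans hτ⟩
    have hxmax : IsLocalMax (W t₀) x₀ := by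
      refine Eventually.of_forall fun x => ?_
      by_cases hx : x ∈ S
      · have h1 : Real.exp (-H.c₀ * t₀) * W t₀ x ≤ Real.exp (-H.c₀ * t₀) * W t₀ x₀ :=
          hmax (a := (t₀, x)) ⟨ht₀, hx⟩
        exact le_of_mul_le_mul_left h1 (Real.exp_pos _)
      · exact (hSW t₀ ht₀ x hx).le.trans hW₀
    have hyC := h.contDiff t₀ ht₀'
    have hWC : ContDiff ℝ 2 (W t₀) :=
      (contDiff_const.mul hyC).add (contDiff_const.mul hB.contDiff)
    have hAW : Aop q b c (W t₀) t₀ x₀ ≤ H.c₀ * W t₀ x₀ := by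
      have h1 : ∀ i, pd1 (W t₀) i x₀ = 0 := fun i => by
        simp [pd1, hxmax.fderiv_eq_zero]
      have h2 : ∑ i, ∑ j, q t₀ x₀ i j * pd2 (W t₀) i j x₀ ≤ 0 := by
        refine sum_mul_pd2_nonpos_of_isLocalMax hWC hxmax (A := Matrix.of (q t₀ x₀)) ?_
        refine Matrix.posSemidef_iff_dotProduct_mulVec.2 ⟨?_, fun ξ => ?_⟩
        · ext i j
          simpa using H.q_symm t₀ htT x₀ j i
        · have h3 := H.ellip t₀ htT x₀ (WithLp.toLp 2 ξ)
          have h4 : 0 ≤ H.ν t₀ x₀ * ‖(WithLp.toLp 2 ξ : ES N)‖ ^ 2 :=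
            mul_nonneg (H.ν₀_pos.le.trans (H.ν_lb t₀ htT x₀)) (sq_nonneg _)
          refine (h4.trans h3).trans_eq ?_
          simp only [dotProduct, Matrix.mulVec, Matrix.of_apply, star_trivial, Finset.mul_sum]
          exact Finset.sum_congr rfl fun _ _ => Finset.sum_congr rfl fun _ _ => by ring
      have h3 := mul_le_mul_of_nonneg_right (H.c_ub t₀ htT x₀) hW₀
      simp only [Aop, h1, mul_zero, Finset.sum_const_zero]
      linarith
    have hWd : HasDerivWithinAt (fun t => W t x₀) (Aop q b c (y t₀) t₀ x₀ + F t₀ x₀ -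
        ((K + ε) * Real.exp (μ * (t₀ - s)) + μ * k t₀) * B x₀) (Icc s τ) t₀ := by
      have := ((h.hasDeriv t₀ ht₀' x₀).const_mul 1).add
        (((hkd t₀).neg.mul_const (B x₀)).hasDerivWithinAt (s := Icc s τ))
      exact this.congr_deriv (by ring)
    set W' := Aop q b c (y t₀) t₀ x₀ + F t₀ x₀ -
        ((K + ε) * Real.exp (μ * (t₀ - s)) + μ * k t₀) * B x₀ with hW'
    have hexp : HasDerivWithinAt (fun t => Real.exp (-H.c₀ * t))
        (Real.exp (-H.c₀ * t₀) * (-H.c₀)) (Icc s τ) t₀ := by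
      simpa using ((hasDerivAt_id t₀).const_mul (-H.c₀)).exp.hasDerivWithinAt
    have hEd := hexp.mul hWd
    have htmax : IsLocalMaxOn (fun t => Real.exp (-H.c₀ * t) * W t x₀) (Icc s τ) t₀ := by
      filter_upwards [self_mem_nhdsWithin] with t ht
      exact hmax (a := (t, x₀)) ⟨ht, hx₀⟩
    have hcone := htmax.hasFDerivWithinAt_nonpos hEd.hasFDerivWithinAt (y := s - t₀)
      (mem_posTangentConeAt_of_segment_subset (by
        rw [add_sub_cancel, segment_symm, segment_eq_Icc hst₀.le]
        exact Icc_subset_Icc le_rfl ht₀.2))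
    have hW'ge : H.c₀ * W t₀ x₀ ≤ W' := by
      have h1 : 0 < Real.exp (-H.c₀ * t₀) * (t₀ - s) :=
        mul_pos (Real.exp_pos _) (sub_pos.2 hst₀)
      simp only [ContinuousLinearMap.toSpanSingleton_apply, smul_eq_mul] at hcone
      by_contra! hlt
      nlinarith [mul_pos h1 (sub_pos.2 hlt)]
    have hAcomb : Aop q b c (W t₀) t₀ x₀ =
        1 * Aop q b c (y t₀) t₀ x₀ + (-k t₀) * Aop q b c B t₀ x₀ :=
      Aop_comb q b c hyC hB.contDiff 1 (-k t₀) t₀ x₀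
    have hkpos : 0 ≤ k t₀ := hε.le.trans (hkε t₀ ht₀)
    have e1 := mul_le_mul_of_nonneg_left (hB.Aop_le t₀ htT x₀) hkpos
    have e2 := hF t₀ ht₀' x₀
    have e3 : (K + ε) * B x₀ ≤ (K + ε) * Real.exp (μ * (t₀ - s)) * B x₀ :=
      mul_le_mul_of_nonneg_right (le_mul_of_one_le_right (by positivity)
        (Real.one_le_exp (mul_nonneg hB.nonneg (sub_nonneg.2 ht₀.1)))) (hBpos x₀).le
    have e4 := mul_pos hε (hBpos x₀)
    nlinarith
  intro t ht x
  have hlim : Tendsto (fun ε : ℝ => (A + K * (t - s) + ε * (1 + (t - s))) *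
      Real.exp (μ * (t - s)) * B x) (𝓝[>] 0)
      (𝓝 ((A + K * (t - s) + 0 * (1 + (t - s))) * Real.exp (μ * (t - s)) * B x)) := by
    refine Tendsto.mono_left ?_ nhdsWithin_le_nhds
    exact Continuous.tendsto (by fun_prop) 0
  rw [zero_mul, add_zero] at hlim
  exact ge_of_tendsto hlim (eventually_nhdsWithin_of_forall fun ε hε => (key ε hε t ht x).le)

lemma abs_le_barrier (H : Hyp N T q b c) {μ : ℝ} {B : ES N → ℝ} (hB : IsBarrier q b c T μ B)
    (h : IsSol q b c s τ F y) (hs : 0 ≤ s) (hτ : τ ≤ T) {A K : ℝ} (hA : 0 ≤ A) (hK : 0 ≤ K)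
    (hinit : ∀ x, |y s x| ≤ A * B x) (hF : ∀ t ∈ Ioc s τ, ∀ x, |F t x| ≤ K * B x) :
    ∀ t ∈ Icc s τ, ∀ x, |y t x| ≤ (A + K * (t - s)) * Real.exp (μ * (t - s)) * B x := by
  intro t ht x
  have h1 := h.le_barrier H hB hs hτ hA hK (fun x => (abs_le.1 (hinit x)).2)
    (fun t ht x => (abs_le.1 (hF t ht x)).2) t ht x
  have h2 := (h.comb h (-1) 0 0).le_barrier H hB hs hτ hA hK
    (fun x => by linarith [(abs_le.1 (hinit x)).1])
    (fun t ht x => by linarith [(abs_le.1 (hF t ht x)).1]) t ht x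
  exact abs_le.2 ⟨by linarith, h1⟩

end IsSol

end MaximumPrinciple

section Conversions

variable {N : ℕ} {T : ℝ} {q : ℝ → ES N → Fin N → Fin N → ℝ}
  {b : ℝ → ES N → Fin N → ℝ} {c : ℝ → ES N → ℝ}

lemma IsBCSol.isSol {s τ : ℝ} {f : ES N → ℝ} {u : ℝ → ES N → ℝ} (h : IsBCSol q b c s τ f u) :
    IsSol q b c s τ (fun _ _ => 0) u := by
  obtain ⟨hbd, hcont, hC, hdiff, -, -, -, heq, -⟩ := h
  refine ⟨hbd, hcont, hC, fun t ht x => ?_⟩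
  rw [add_zero, ← heq t ht x]
  exact (hdiff x t ht).hasDerivAt.hasDerivWithinAt

/-- Spatial continuity and a jointly continuous time derivative give joint continuity. -/
lemma continuousOn_of_derivWithin {u : ℝ → ES N → ℝ}
    (hx : ∀ t ∈ Icc (0 : ℝ) T, Continuous (u t))
    (hdiff : ∀ x, ∀ t ∈ Icc (0 : ℝ) T,
      DifferentiableWithinAt ℝ (fun t' => u t' x) (Icc (0 : ℝ) T) t)
    (hcont : ContinuousOn (fun p : ℝ × ES N => derivWithin (fun t' => u t' p.2) (Icc (0 : ℝ) T) p.1)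
      (Icc (0 : ℝ) T ×ˢ univ)) :
    ContinuousOn (fun p : ℝ × ES N => u p.1 p.2) (Icc (0 : ℝ) T ×ˢ univ) := by
  rintro ⟨t₀, x₀⟩ ⟨ht₀, -⟩
  simp only at ht₀
  obtain ⟨L, hL⟩ := (isCompact_Icc.prod (isCompact_closedBall x₀ 1)).exists_bound_of_continuousOn
    (hcont.mono (prod_mono le_rfl (subset_univ (closedBall x₀ 1))))
  rw [ContinuousWithinAt, tendsto_iff_dist_tendsto_zero]
  have hbound : ∀ᶠ p : ℝ × ES N in 𝓝[Icc (0 : ℝ) T ×ˢ univ] (t₀, x₀),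
      dist (u p.1 p.2) (u t₀ x₀) ≤ L * ‖p.1 - t₀‖ + dist (u t₀ p.2) (u t₀ x₀) := by
    have hball : ∀ᶠ p : ℝ × ES N in 𝓝[Icc (0 : ℝ) T ×ˢ univ] (t₀, x₀), p.2 ∈ closedBall x₀ 1 :=
      nhdsWithin_le_nhds
        (continuous_snd.continuousAt.preimage_mem_nhds (closedBall_mem_nhds x₀ one_pos))
    filter_upwards [hball, self_mem_nhdsWithin] with p hp hpT
    have h1 := (convex_Icc (0 : ℝ) T).norm_image_sub_le_of_norm_derivWithin_le
      (f := fun t' => u t' p.2) (hdiff p.2) (fun t ht => hL (t, p.2) ⟨ht, hp⟩) ht₀ hpT.1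
    refine (dist_triangle _ (u t₀ p.2) _).trans (add_le_add_left ?_ _)
    rwa [dist_eq_norm]
  refine squeeze_zero' (Eventually.of_forall fun _ => dist_nonneg) hbound ?_
  have hlim : Continuous fun p : ℝ × ES N => L * ‖p.1 - t₀‖ + dist (u t₀ p.2) (u t₀ x₀) :=
    (by fun_prop : Continuous fun p : ℝ × ES N => L * ‖p.1 - t₀‖).add
      (((hx t₀ ht₀).comp continuous_snd).dist continuous_const)
  simpa using (hlim.tendsto (t₀, x₀)).mono_left nhdsWithin_le_nhds

lemma IsBCSolInhom.isSol {f : ES N → ℝ} {g u : ℝ → ES N → ℝ} (h : IsBCSolInhom q b c T f g u) :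
    IsSol q b c 0 T g u := by
  obtain ⟨hbd, hC, hdiff, hcont, -, -, heq, -⟩ := h
  refine ⟨hbd, continuousOn_of_derivWithin (fun t ht => (hC t ht).continuous) hdiff hcont,
    fun t ht => hC t (Ioc_subset_Icc_self ht), fun t ht x => ?_⟩
  rw [← heq t (Ioc_subset_Icc_self ht) x]
  exact (hdiff x t (Ioc_subset_Icc_self ht)).hasDerivWithinAt

lemma exists_bound_mul_of_parabolicHolderOn {δ : ℝ} (hδ : 0 < δ) (hT : 0 ≤ T)
    {h : ℝ → ES N → ℝ} (hh : ∀ R > 0, ParabolicHolderOn T δ R h) {ψ : ES N → ℝ}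
    (hψ : Continuous ψ) (hψs : HasCompactSupport ψ) :
    ∃ M, ∀ t ∈ Icc (0 : ℝ) T, ∀ x, |h t x * ψ x| ≤ M := by
  obtain ⟨R, hR, hsub⟩ := hψs.isCompact.isBounded.subset_closedBall_lt 0 0
  obtain ⟨C, hC⟩ := hh R hR
  obtain ⟨P, hP⟩ := hψs.exists_bound_of_continuous hψ
  have hP0 : 0 ≤ P := (norm_nonneg _).trans (hP 0)
  have h00 : (0 : ℝ) ∈ Icc 0 T := ⟨le_rfl, hT⟩
  have h0R : (0 : ES N) ∈ closedBall 0 R := mem_closedBall_self hR.le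
  refine ⟨(|h 0 0| + |C| * (T + R ^ 2) ^ (δ / 2)) * P, fun t ht x => ?_⟩
  have hT2 : 0 ≤ (T + R ^ 2) ^ (δ / 2) := by positivity
  by_cases hx : x ∈ tsupport ψ
  · have hxR := hsub hx
    have h1 := hC t ht 0 h00 x hxR 0 h0R
    have h2 : (|t - 0| + ‖x - 0‖ ^ 2) ^ (δ / 2) ≤ (T + R ^ 2) ^ (δ / 2) := by
      have h3 : ‖x‖ ≤ R := by simpa using hxR
      rw [sub_zero, sub_zero, abs_of_nonneg ht.1]
      gcongr
      exact add_nonneg ht.1 (sq_nonneg _)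
      exact ht.2
    have h4 : C * (|t - 0| + ‖x - 0‖ ^ 2) ^ (δ / 2) ≤ |C| * (T + R ^ 2) ^ (δ / 2) :=
      mul_le_mul (le_abs_self C) h2 (by positivity) (abs_nonneg C)
    have h5 : |h t x| ≤ |h 0 0| + |C| * (T + R ^ 2) ^ (δ / 2) := by
      have := abs_sub_abs_le_abs_sub (h t x) (h 0 0)
      linarith
    rw [abs_mul]
    exact mul_le_mul h5 (hP x) (abs_nonneg _) (by positivity)
  · rw [image_eq_zero_of_notMem_tsupport hx, mul_zero, abs_zero]
    positivity

lemma Hyp.exists_bound_Aop (H : Hyp N T q b c) {φ : ES N → ℝ} (hφ : ContDiff ℝ 2 φ)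
    (hφs : HasCompactSupport φ) :
    ∃ M, 0 ≤ M ∧ ∀ t ∈ Icc (0 : ℝ) T, ∀ x, |Aop q b c φ t x| ≤ M := by
  have hs1 : ∀ i, HasCompactSupport (pd1 φ i) := fun i => hφs.fderiv_apply ℝ _
  have hs2 : ∀ i j, HasCompactSupport (pd2 φ i j) := fun i j => (hs1 j).fderiv_apply ℝ _
  have hC1 : ∀ i, ContDiff ℝ 1 (pd1 φ i) := contDiff_pd1 (n := 2) (m := 1) hφ le_rfl
  have hC2 : ∀ i j, ContDiff ℝ 0 (pd2 φ i j) := fun i j =>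
    contDiff_pd1 (n := 1) (m := 0) (hC1 j) le_rfl i
  choose M₂ hM₂ using fun i j => exists_bound_mul_of_parabolicHolderOn H.δ_mem.1 H.T_pos.le
    (fun R hR => H.holder_q R hR i j) (hC2 i j).continuous (hs2 i j)
  choose M₁ hM₁ using fun j => exists_bound_mul_of_parabolicHolderOn H.δ_mem.1 H.T_pos.le
    (fun R hR => H.holder_b R hR j) (hC1 j).continuous (hs1 j)
  obtain ⟨M₀, hM₀⟩ := exists_bound_mul_of_parabolicHolderOn H.δ_mem.1 H.T_pos.le
    H.holder_c hφ.continuous hφs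
  have hbd : ∀ t ∈ Icc (0 : ℝ) T, ∀ x,
      |Aop q b c φ t x| ≤ (∑ i, ∑ j, M₂ i j) + (∑ j, M₁ j) + M₀ := by
    intro t ht x
    refine (abs_add_le _ _).trans (add_le_add ((abs_add_le _ _).trans (add_le_add ?_ ?_))
      (hM₀ t ht x))
    · refine (Finset.abs_sum_le_sum_abs _ _).trans (Finset.sum_le_sum fun i _ => ?_)
      exact (Finset.abs_sum_le_sum_abs _ _).trans (Finset.sum_le_sum fun j _ => hM₂ i j t ht x)
    · exact (Finset.abs_sum_le_sum_abs _ _).trans (Finset.sum_le_sum fun j _ => hM₁ j t ht x)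
  exact ⟨_, (abs_nonneg _).trans (hbd 0 ⟨le_rfl, H.T_pos.le⟩ 0), hbd⟩

lemma IsSol.of_contDiff {φ : ES N → ℝ} (hφ : ContDiff ℝ 2 φ) (hφs : HasCompactSupport φ)
    (s τ : ℝ) : IsSol q b c s τ (fun t x => -Aop q b c φ t x) (fun _ => φ) where
  bounded := (hφs.exists_bound_of_continuous hφ.continuous).imp fun _ hM _ _ x => hM x
  continuousOn := (hφ.continuous.comp continuous_snd).continuousOn
  contDiff _ _ := hφ
  hasDeriv t _ x := by
    rw [add_neg_cancel]
    exact hasDerivWithinAt_const _ _ _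

lemma exists_bound_of_iSup_CbNorm {θ : ℝ} {g : ℝ → ES N → ℝ}
    (hg : (⨆ t ∈ Icc (0 : ℝ) T, CbNorm θ (g t)) ≠ ⊤) :
    ∃ G, 0 ≤ G ∧ ∀ t ∈ Icc (0 : ℝ) T, ∀ x, |g t x| ≤ G := by
  refine ⟨_, ENNReal.toReal_nonneg, fun t ht x => (ENNReal.ofReal_le_iff_le_toReal hg).1 ?_⟩
  calc ENNReal.ofReal |g t x| = ENNReal.ofReal ‖iteratedFDeriv ℝ 0 (g t) x‖ := by simp
    _ ≤ supNormE 0 (g t) := le_iSup (fun x => ENNReal.ofReal ‖iteratedFDeriv ℝ 0 (g t) x‖) x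
    _ ≤ ∑ k ∈ Finset.range (⌊θ⌋₊ + 1), supNormE k (g t) :=
      Finset.single_le_sum (f := fun k => supNormE k (g t)) (fun _ _ => zero_le)
        (Finset.mem_range.2 (Nat.succ_pos _))
    _ ≤ CbNorm θ (g t) := le_self_add
    _ ≤ _ := le_iSup₂ (f := fun t (_ : t ∈ Icc (0 : ℝ) T) => CbNorm θ (g t)) t ht

/-- Approximation by compactly supported smooth functions, in the norm weighted by a function
that tends to infinity. -/
lemma exists_contDiff_weighted_approx {B : ES N → ℝ} (hB1 : ∀ x, 1 ≤ B x)
    (hB : Tendsto B (cocompact (ES N)) atTop) {g : ℝ → ES N → ℝ}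
    (hg : ContinuousOn (fun p : ℝ × ES N => g p.1 p.2) (Icc (0 : ℝ) T ×ˢ univ)) {G : ℝ}
    (hG : ∀ t ∈ Icc (0 : ℝ) T, ∀ x, |g t x| ≤ G) {t₀ : ℝ} (ht₀ : t₀ ∈ Icc (0 : ℝ) T)
    {η : ℝ} (hη : 0 < η) :
    ∃ φ : ES N → ℝ, ContDiff ℝ 2 φ ∧ HasCompactSupport φ ∧ ∃ ρ > 0, ∀ t ∈ Icc (0 : ℝ) T,
      |t - t₀| < ρ → ∀ x, |g t x - φ x| ≤ η * B x := by
  obtain ⟨S, hS, hSsub⟩ := mem_cocompact.1 (hB.eventually_ge_atTop ((2 * G + η) / η))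
  obtain ⟨R, hR, hSR⟩ := hS.isBounded.subset_closedBall_lt 0 0
  let χ : ContDiffBump (0 : ES N) := ⟨R, R + 1, hR, by linarith⟩
  have hgt₀ : Continuous (g t₀) := by
    have := hg.comp_continuous (f := fun x : ES N => (t₀, x)) (by fun_prop)
      (fun x => ⟨ht₀, mem_univ x⟩)
    exact this
  obtain ⟨φ, hφC, hφa, hφs⟩ := (χ.continuous.mul hgt₀).exists_contDiff_approx 2
    (ε := fun _ => η / 2) continuous_const (fun _ => half_pos hη)
  refine ⟨φ, by exact_mod_cast hφC, ?_, ?_⟩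
  · exact (χ.hasCompactSupport.mul_right (f' := g t₀)).mono hφs
  obtain ⟨ρ, hρ, hunif⟩ := Metric.uniformContinuousOn_iff.1
    ((isCompact_Icc.prod (isCompact_closedBall (0 : ES N) R)).uniformContinuousOn_of_continuous
      (hg.mono (prod_mono le_rfl (subset_univ _)))) (η / 2) (half_pos hη)
  refine ⟨ρ, hρ, fun t ht htρ x => ?_⟩
  have h1 := hφa x
  rw [Real.dist_eq, abs_sub_comm] at h1
  by_cases hx : x ∈ closedBall (0 : ES N) R
  · have h2 := hunif (t, x) ⟨ht, hx⟩ (t₀, x) ⟨ht₀, hx⟩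
      (by rw [dist_prod_same_right]; exact htρ)
    rw [Real.dist_eq] at h2
    have h3 : χ x = 1 := χ.one_of_mem_closedBall hx
    rw [Pi.mul_apply, h3, one_mul] at h1
    have h4 := abs_sub_le (g t x) (g t₀ x) (φ x)
    have h5 := mul_le_mul_of_nonneg_left (hB1 x) hη.le
    linarith
  · have h2 : (2 * G + η) / η ≤ B x := hSsub fun hxS => hx (hSR hxS)
    rw [div_le_iff₀ hη] at h2
    have h3 : |χ x * g t₀ x| ≤ G := by
      rw [abs_mul, abs_of_nonneg χ.nonneg]
      exact (mul_le_of_le_one_left (abs_nonneg _) χ.le_one).trans (hG t₀ ht₀ x)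
    have h4 := abs_sub_le (g t x) (χ x * g t₀ x) (φ x)
    have h5 := abs_sub (g t x) (χ x * g t₀ x)
    have h6 := hG t ht x
    rw [Pi.mul_apply] at h1
    linarith

end Conversions

section Duhamel

variable {N : ℕ} {T : ℝ} {q : ℝ → ES N → Fin N → Fin N → ℝ}
  {b : ℝ → ES N → Fin N → ℝ} {c : ℝ → ES N → ℝ} {g : ℝ → ES N → ℝ} {v : ℝ → ℝ → ES N → ℝ}
  {μ : ℝ} {B : ES N → ℝ}

/-- In the weighted norm, solutions of the homogeneous problem stay close to their initial datum
for short times, locally uniformly in the initial time. -/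
lemma exists_forall_abs_sub_le_near (H : Hyp N T q b c) (hB : IsBarrier q b c T μ B)
    (hg : ContinuousOn (fun p : ℝ × ES N => g p.1 p.2) (Icc (0 : ℝ) T ×ˢ univ)) {G : ℝ}
    (hG : ∀ t ∈ Icc (0 : ℝ) T, ∀ x, |g t x| ≤ G)
    (hv : ∀ r ∈ Ico (0 : ℝ) T, IsSol q b c r T (fun _ _ => 0) (v r))
    (hv₀ : ∀ r ∈ Ico (0 : ℝ) T, ∀ x, v r r x = g r x) {t₀ : ℝ} (ht₀ : t₀ ∈ Icc (0 : ℝ) T)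
    {η : ℝ} (hη : 0 < η) :
    ∃ ρ > 0, ∀ r ∈ Ico (0 : ℝ) T, ∀ s ∈ Icc (0 : ℝ) T, ∀ t ∈ Icc r T, r ∈ ball t₀ ρ →
      s ∈ ball t₀ ρ → t ∈ ball t₀ ρ → ∀ x, |v r t x - g s x| ≤ η * B x := by
  have hE := Real.exp_pos (μ * T)
  have hE1 : 1 ≤ Real.exp (μ * T) := Real.one_le_exp (mul_nonneg hB.nonneg H.T_pos.le)
  obtain ⟨φ, hφ, hφs, ρ, hρ, happ⟩ := exists_contDiff_weighted_approx hB.one_le hB.tendsto hg hG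
    ht₀ (η := η / (4 * Real.exp (μ * T))) (by positivity)
  obtain ⟨A, hA, hAφ⟩ := H.exists_bound_Aop hφ hφs
  refine ⟨min ρ (η / (8 * Real.exp (μ * T) * (A + 1))), lt_min hρ (by positivity),
    fun r hr s hs t ht hrb hsb htb x => ?_⟩
  have hBpos : 0 < B x := one_pos.trans_le (hB.one_le x)
  simp only [mem_ball, Real.dist_eq, lt_min_iff] at hrb hsb htb
  have hrT : r ∈ Icc (0 : ℝ) T := Ico_subset_Icc_self hr
  have h1 := ((hv r hr).comb (IsSol.of_contDiff hφ hφs r T) 1 (-1) 0).abs_le_barrier H hB hr.1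
    le_rfl (A := η / (4 * Real.exp (μ * T))) (K := A) (by positivity) hA
    (fun x => by
      rw [hv₀ r hr x]
      refine le_trans (le_of_eq ?_) (happ r hrT hrb.1 x)
      congr 1; ring)
    (fun t ht x => by
      refine le_trans (le_of_eq ?_) ((hAφ t ⟨hr.1.trans ht.1.le, ht.2⟩ x).trans
        (le_mul_of_one_le_right hA (hB.one_le x)))
      congr 1; ring) t ht x
  have h2 : η / (4 * Real.exp (μ * T)) + A * (t - r) ≤ η / (2 * Real.exp (μ * T)) := by
    have h3 : t - r ≤ η / (4 * Real.exp (μ * T) * (A + 1)) := by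
      have e1 := abs_lt.1 hrb.2
      have e2 := abs_lt.1 htb.2
      have e3 : η / (4 * Real.exp (μ * T) * (A + 1))
          = 2 * (η / (8 * Real.exp (μ * T) * (A + 1))) := by field_simp; norm_num
      linarith
    have h4 : (A + 1) * (η / (4 * Real.exp (μ * T) * (A + 1))) = η / (4 * Real.exp (μ * T)) := by
      field_simp
    have h5 : A * (t - r) ≤ (A + 1) * (η / (4 * Real.exp (μ * T) * (A + 1))) :=
      mul_le_mul (by linarith) h3 (sub_nonneg.2 ht.1) (by linarith)
    have h6 : η / (2 * Real.exp (μ * T)) = 2 * (η / (4 * Real.exp (μ * T))) := by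
      field_simp; norm_num
    linarith
  have h3 : Real.exp (μ * (t - r)) ≤ Real.exp (μ * T) := by
    refine Real.exp_le_exp.2 (mul_le_mul_of_nonneg_left ?_ hB.nonneg)
    linarith [hr.1, ht.2]
  have h4 : |v r t x - φ x| ≤ η / 2 * B x := by
    calc |v r t x - φ x| = |1 * v r t x + (-1 + 0 * t) * φ x| := by congr 1; ring
      _ ≤ _ := h1
      _ ≤ η / (2 * Real.exp (μ * T)) * Real.exp (μ * T) * B x := by gcongr
      _ = η / 2 * B x := by field_simp
  have h5 := happ s hs hsb.1 x
  have h6 : η / (4 * Real.exp (μ * T)) * B x ≤ η / 2 * B x := by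
    refine mul_le_mul_of_nonneg_right ?_ hBpos.le
    rw [div_le_div_iff_of_pos_left hη (by positivity) two_pos]
    linarith
  have h7 := abs_sub_le (v r t x) (φ x) (g s x)
  rw [abs_sub_comm (φ x)] at h7
  linarith

lemma exists_forall_abs_sub_le (H : Hyp N T q b c) (hB : IsBarrier q b c T μ B)
    (hg : ContinuousOn (fun p : ℝ × ES N => g p.1 p.2) (Icc (0 : ℝ) T ×ˢ univ)) {G : ℝ}
    (hG : ∀ t ∈ Icc (0 : ℝ) T, ∀ x, |g t x| ≤ G)
    (hv : ∀ r ∈ Ico (0 : ℝ) T, IsSol q b c r T (fun _ _ => 0) (v r))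
    (hv₀ : ∀ r ∈ Ico (0 : ℝ) T, ∀ x, v r r x = g r x) {η : ℝ} (hη : 0 < η) :
    ∃ δ > 0, ∀ r ∈ Ico (0 : ℝ) T, ∀ s ∈ Icc (0 : ℝ) T, ∀ t ∈ Icc r T, |s - r| < δ → t - r < δ →
      ∀ x, |v r t x - g s x| ≤ η * B x := by
  choose! ρ hρ hclose using fun t₀ (ht₀ : t₀ ∈ Icc (0 : ℝ) T) =>
    exists_forall_abs_sub_le_near H hB hg hG hv hv₀ ht₀ hη
  obtain ⟨δ, hδ, hleb⟩ := lebesgue_number_lemma_of_metric (isCompact_Icc (a := 0) (b := T))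
    (c := fun i : Icc (0 : ℝ) T => ball (i : ℝ) (ρ i)) (fun _ => isOpen_ball)
    (fun t ht => mem_iUnion.2 ⟨⟨t, ht⟩, mem_ball_self (hρ t ht)⟩)
  refine ⟨δ, hδ, fun r hr s hs t ht hsr htr x => ?_⟩
  obtain ⟨i, hi⟩ := hleb r (Ico_subset_Icc_self hr)
  refine hclose i i.2 r hr s hs t ht (hi (mem_ball_self hδ)) (hi ?_) (hi ?_) x
  · rwa [mem_ball, Real.dist_eq]
  · rwa [mem_ball, Real.dist_eq, abs_of_nonneg (sub_nonneg.2 ht.1)]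

/-- Dependence of the homogeneous solutions on the initial time. -/
lemma abs_sub_le_of_initial (H : Hyp N T q b c) (hB : IsBarrier q b c T μ B)
    (hv : ∀ r ∈ Ico (0 : ℝ) T, IsSol q b c r T (fun _ _ => 0) (v r))
    (hv₀ : ∀ r ∈ Ico (0 : ℝ) T, ∀ x, v r r x = g r x) {η : ℝ} (hη : 0 ≤ η) {r r' : ℝ}
    (hr : r ∈ Ico (0 : ℝ) T) (hr' : r' ∈ Ico (0 : ℝ) T) (hrr' : r ≤ r')
    (hclose : ∀ x, |v r r' x - g r' x| ≤ η * B x) :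
    ∀ t ∈ Icc r' T, ∀ x, |v r t x - v r' t x| ≤ η * Real.exp (μ * T) * B x := by
  intro t ht x
  have h1 := (((hv r hr).mono hrr' le_rfl).comb (hv r' hr') 1 (-1) 0).abs_le_barrier H hB hr'.1
    le_rfl hη le_rfl
    (fun x => by
      rw [hv₀ r' hr' x]
      refine le_trans (le_of_eq ?_) (hclose x)
      congr 1; ring)
    (fun t _ x => by simp) t ht x
  have hBpos : 0 < B x := one_pos.trans_le (hB.one_le x)
  calc |v r t x - v r' t x| = |1 * v r t x + (-1 + 0 * t) * v r' t x| := by congr 1; ring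
    _ ≤ _ := h1
    _ ≤ η * Real.exp (μ * T) * B x := by
      rw [zero_mul, add_zero]
      have : Real.exp (μ * (t - r')) ≤ Real.exp (μ * T) :=
        Real.exp_le_exp.2 (mul_le_mul_of_nonneg_left (by linarith [hr'.1, ht.2]) hB.nonneg)
      gcongr

/-- The solution with source `g` is close to the Riemann sums of the homogeneous solutions. -/
lemma IsSol.abs_sub_sum_le (H : Hyp N T q b c) (hB : IsBarrier q b c T μ B)
    (hv : ∀ r ∈ Ico (0 : ℝ) T, IsSol q b c r T (fun _ _ => 0) (v r)) {z : ℝ → ES N → ℝ}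
    (hz : IsSol q b c 0 T g z) (hz₀ : ∀ x, z 0 x = 0) {η h : ℝ} (hη : 0 ≤ η) (hh : 0 < h)
    (hclose : ∀ r ∈ Ico (0 : ℝ) T, ∀ t ∈ Icc r T, t ≤ r + h → ∀ x, |g t x - v r t x| ≤ η * B x)
    (k : ℕ) (hk : k * h ≤ T) :
    IsSol q b c (k * h) T g (fun t x => z t x - ∑ j ∈ Finset.range k, h * v (j * h) t x) ∧
    ∀ x, |z (k * h) x - ∑ j ∈ Finset.range k, h * v (j * h) (k * h) x|
      ≤ η * (k * h) * Real.exp (μ * (k * h)) * B x := by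
  induction k with
  | zero => simpa [hz₀] using hz
  | succ k ih =>
    push_cast at hk ⊢
    have hlt : k * h < T := by linarith
    obtain ⟨hS, hbd⟩ := ih hlt.le
    have hr : k * h ∈ Ico (0 : ℝ) T := ⟨by positivity, hlt⟩
    have hle : k * h ≤ (k + 1) * h := by linarith
    constructor
    · have h1 := (hS.comb (hv _ hr) 1 (-h) 0).mono hle le_rfl
      convert h1 using 3 with t x t x
      · ring
      · rw [Finset.sum_range_succ]; ring
    · intro x
      have h1 := ((hS.comb (hv _ hr) 1 (k * h) (-1)).mono le_rfl hk).abs_le_barrier H hB hr.1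
        hk (A := η * (k * h) * Real.exp (μ * (k * h))) (K := η) (by positivity) hη
        (fun x => by
          refine le_trans (le_of_eq ?_) (hbd x)
          congr 1; ring)
        (fun t ht x => by
          refine le_trans (le_of_eq ?_) (hclose _ hr t ⟨ht.1.le, ht.2.trans hk⟩
            (by linarith [ht.2]) x)
          congr 1; ring) ((k + 1) * h) ⟨hle, le_rfl⟩ x
      have hBpos : 0 < B x := one_pos.trans_le (hB.one_le x)
      have e1 : 1 ≤ Real.exp (μ * (k * h)) :=
        Real.one_le_exp (mul_nonneg hB.nonneg hr.1)
      have e2 : Real.exp (μ * (k * h)) * Real.exp (μ * ((k + 1) * h - k * h))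
          = Real.exp (μ * ((k + 1) * h)) := by
        rw [← Real.exp_add]; congr 1; ring
      calc _ = |1 * (z ((k + 1) * h) x - ∑ j ∈ Finset.range k, h * v (j * h) ((k + 1) * h) x)
            + (k * h + -1 * ((k + 1) * h)) * v (k * h) ((k + 1) * h) x| := by
            rw [Finset.sum_range_succ]; congr 1; ring
        _ ≤ _ := h1
        _ ≤ (η * (k * h) * Real.exp (μ * (k * h)) + η * h * Real.exp (μ * (k * h))) *
            Real.exp (μ * ((k + 1) * h - k * h)) * B x := by
          have e3 : η * ((k + 1) * h - k * h) ≤ η * h * Real.exp (μ * (k * h)) := by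
            have : (k + 1) * h - k * h = h := by ring
            rw [this]
            exact le_mul_of_one_le_right (by positivity) e1
          gcongr
        _ = η * ((k + 1) * h) * (Real.exp (μ * (k * h)) *
            Real.exp (μ * ((k + 1) * h - k * h))) * B x := by ring
        _ = _ := by rw [e2]

/-- A function that is continuous and bounded on `[a,b)` is interval integrable. -/
lemma intervalIntegrable_of_continuousOn_Ico {a b M : ℝ} (hab : a ≤ b) {p : ℝ → ℝ}
    (hp : ContinuousOn p (Ico a b)) (hM : ∀ r ∈ Ico a b, |p r| ≤ M) :
    IntervalIntegrable p volume a b := by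
  rw [intervalIntegrable_iff_integrableOn_Ico_of_le hab]
  exact Integrable.of_bound (hp.aestronglyMeasurable measurableSet_Ico) M
    ((ae_restrict_iff' measurableSet_Ico).2 (Eventually.of_forall hM))

/-- Left-endpoint Riemann sums approximate the integral. -/
lemma abs_sum_sub_integral_le {p : ℝ → ℝ} {h ω : ℝ} (hh : 0 < h) {n : ℕ}
    (hint : IntervalIntegrable p volume 0 (n * h))
    (hp : ∀ j < n, ∀ r ∈ Ico (j * h) ((j + 1) * h), |p (j * h) - p r| ≤ ω) :
    |∑ j ∈ Finset.range n, h * p (j * h) - ∫ r in (0 : ℝ)..(n * h), p r| ≤ ω * (n * h) := by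
  have hsub : ∀ j < n, IntervalIntegrable p volume (j * h) ((j + 1 : ℕ) * h) := by
    intro j hj
    refine hint.mono_set ?_
    have hj' : ((j + 1 : ℕ) : ℝ) ≤ n := by exact_mod_cast hj
    rw [uIcc_of_le (by push_cast; linarith), uIcc_of_le (by positivity)]
    exact Icc_subset_Icc (by positivity) (by gcongr)
  have hsum := intervalIntegral.sum_integral_adjacent_intervals (a := fun j : ℕ => j * h) hsub
  simp only [Nat.cast_zero, zero_mul] at hsum
  rw [← hsum, ← Finset.sum_sub_distrib]
  refine (Finset.abs_sum_le_sum_abs _ _).trans ?_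
  have hterm : ∀ j ∈ Finset.range n,
      |h * p (j * h) - ∫ r in (j * h)..((j + 1 : ℕ) * h), p r| ≤ ω * h := by
    intro j hj
    have hj := Finset.mem_range.1 hj
    have hlen : ((j + 1 : ℕ) : ℝ) * h - j * h = h := by push_cast; ring
    have h1 : h * p (j * h) - ∫ r in (j * h)..((j + 1 : ℕ) * h), p r
        = ∫ r in (j * h)..((j + 1 : ℕ) * h), (p (j * h) - p r) := by
      rw [intervalIntegral.integral_sub intervalIntegrable_const (hsub j hj),
        intervalIntegral.integral_const, hlen, smul_eq_mul]
    rw [h1]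
    have h2 := intervalIntegral.norm_integral_le_of_norm_le_const_ae (a := j * h)
      (b := (j + 1 : ℕ) * h) (C := ω) (f := fun r => p (j * h) - p r) (by
        filter_upwards [Measure.ae_ne volume (((j + 1 : ℕ) : ℝ) * h)] with r hr hmem
        rw [uIoc_of_le (by linarith)] at hmem
        push_cast at hr hmem
        exact hp j hj r ⟨hmem.1.le, lt_of_le_of_ne hmem.2 hr⟩)
    rwa [hlen, abs_of_pos hh, Real.norm_eq_abs] at h2
  refine (Finset.sum_le_sum hterm).trans_eq ?_
  rw [Finset.sum_const, Finset.card_range, nsmul_eq_mul]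
  ring

lemma IsSol.eq_integral (H : Hyp N T q b c) (hB : IsBarrier q b c T μ B)
    (hg : ContinuousOn (fun p : ℝ × ES N => g p.1 p.2) (Icc (0 : ℝ) T ×ˢ univ)) {G : ℝ}
    (hG0 : 0 ≤ G) (hG : ∀ t ∈ Icc (0 : ℝ) T, ∀ x, |g t x| ≤ G)
    (hv : ∀ r ∈ Ico (0 : ℝ) T, IsSol q b c r T (fun _ _ => 0) (v r))
    (hv₀ : ∀ r ∈ Ico (0 : ℝ) T, ∀ x, v r r x = g r x) {z : ℝ → ES N → ℝ}
    (hz : IsSol q b c 0 T g z) (hz₀ : ∀ x, z 0 x = 0) {t : ℝ} (ht : t ∈ Icc (0 : ℝ) T)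
    (x : ES N) : z t x = ∫ r in (0 : ℝ)..t, v r t x := by
  rcases ht.1.eq_or_lt with rfl | htpos
  · simp [hz₀]
  have hBpos : 0 < B x := one_pos.trans_le (hB.one_le x)
  have hE := Real.exp_pos (μ * T)
  have hIco : ∀ {r}, r ∈ Ico 0 t → r ∈ Ico 0 T := fun hr => ⟨hr.1, hr.2.trans_le ht.2⟩
  have hmod : ∀ η > 0, ∃ δ > 0, ∀ r ∈ Ico 0 t, ∀ r' ∈ Ico 0 t, r ≤ r' → r' - r < δ →
      |v r t x - v r' t x| ≤ η * Real.exp (μ * T) * B x := by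
    intro η hη
    obtain ⟨δ, hδ, hclose⟩ := exists_forall_abs_sub_le H hB hg hG hv hv₀ hη
    refine ⟨δ, hδ, fun r hr r' hr' hrr' hd => ?_⟩
    have hr'T := Ico_subset_Icc_self (hIco hr')
    exact abs_sub_le_of_initial H hB hv hv₀ hη.le (hIco hr) (hIco hr') hrr'
      (hclose r (hIco hr) r' hr'T r' ⟨hrr', hr'T.2⟩
        (by rwa [abs_of_nonneg (sub_nonneg.2 hrr')]) hd) t ⟨hr'.2.le, ht.2⟩ x
  have hint : IntervalIntegrable (fun r => v r t x) volume 0 t := by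
    refine intervalIntegrable_of_continuousOn_Ico (M := G * Real.exp (μ * T) * B x) htpos.le ?_ ?_
    · refine Metric.continuousOn_iff.2 fun r hr ε hε => ?_
      obtain ⟨δ, hδ, hd⟩ := hmod (ε / (2 * (Real.exp (μ * T) * B x))) (by positivity)
      have hhalf : ε / (2 * (Real.exp (μ * T) * B x)) * Real.exp (μ * T) * B x = ε / 2 := by
        field_simp
      refine ⟨δ, hδ, fun r' hr' hrr' => ?_⟩
      rw [Real.dist_eq] at hrr' ⊢
      have hlt := abs_lt.1 hrr'
      rcases le_total r r' with hle | hle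
      · have := hd r hr r' hr' hle hlt.2
        rw [abs_sub_comm]; linarith
      · have := hd r' hr' r hr hle (by linarith)
        linarith
    · intro r hr
      have h1 := (hv r (hIco hr)).abs_le_barrier H hB hr.1 le_rfl hG0 le_rfl
        (fun x => by
          rw [hv₀ r (hIco hr) x]
          exact (hG r (Ico_subset_Icc_self (hIco hr)) x).trans
            (le_mul_of_one_le_right hG0 (hB.one_le x)))
        (fun t _ x => by simp) t ⟨hr.2.le, ht.2⟩ x
      refine h1.trans ?_
      rw [zero_mul, add_zero]
      have : Real.exp (μ * (t - r)) ≤ Real.exp (μ * T) :=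
        Real.exp_le_exp.2 (mul_le_mul_of_nonneg_left (by linarith [hr.1, ht.2]) hB.nonneg)
      gcongr
  have hsmall : ∀ η > 0, |z t x - ∫ r in (0 : ℝ)..t, v r t x|
      ≤ η * (2 * t * Real.exp (μ * T) * B x) := by
    intro η hη
    obtain ⟨δ₁, hδ₁, hclose⟩ := exists_forall_abs_sub_le H hB hg hG hv hv₀ hη
    obtain ⟨δ₂, hδ₂, hmodη⟩ := hmod η hη
    obtain ⟨n, hn⟩ := exists_nat_gt (t / min δ₁ δ₂)
    have hδ : 0 < min δ₁ δ₂ := lt_min hδ₁ hδ₂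
    have hn0 : (0 : ℝ) < n := (div_pos htpos hδ).trans hn
    have hh : 0 < t / n := div_pos htpos hn0
    have hhδ : t / n < min δ₁ δ₂ := by
      rw [div_lt_iff₀ hδ] at hn
      rwa [div_lt_iff₀ hn0, mul_comm]
    have hnt : n * (t / n) = t := by field_simp
    have h1 := (hz.abs_sub_sum_le H hB hv hz₀ hη.le hh (fun r hr s hs hsr x => by
      have hd : s - r < δ₁ := by linarith [min_le_left δ₁ δ₂]
      rw [abs_sub_comm]
      exact hclose r hr s ⟨hr.1.trans hs.1, hs.2⟩ s hs
        (by rwa [abs_of_nonneg (sub_nonneg.2 hs.1)]) hd x) n (hnt.le.trans ht.2)).2 x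
    have h2 := abs_sum_sub_integral_le (p := fun r => v r t x) (n := n) hh
      (ω := η * Real.exp (μ * T) * B x) (by rwa [hnt]) (fun j hj r hr => by
        have hj' : ((j : ℝ) + 1) * (t / n) ≤ t := by
          calc ((j : ℝ) + 1) * (t / n) ≤ n * (t / n) := by
                gcongr
                exact_mod_cast hj
            _ = t := hnt
        have hj0 : 0 ≤ j * (t / n) := by positivity
        exact hmodη _ ⟨hj0, by linarith⟩ r ⟨hj0.trans hr.1, hr.2.trans_le hj'⟩ hr.1
          (by linarith [hr.2, min_le_right δ₁ δ₂]))
    rw [hnt] at h1 h2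
    have h3 : Real.exp (μ * t) ≤ Real.exp (μ * T) :=
      Real.exp_le_exp.2 (mul_le_mul_of_nonneg_left ht.2 hB.nonneg)
    have h4 : η * t * Real.exp (μ * t) * B x ≤ η * t * Real.exp (μ * T) * B x := by gcongr
    have h5 := abs_sub_le (z t x) (∑ j ∈ Finset.range n, t / n * v (j * (t / n)) t x)
      (∫ r in (0 : ℝ)..t, v r t x)
    linarith
  have hlim : Tendsto (fun η : ℝ => η * (2 * t * Real.exp (μ * T) * B x)) (𝓝[>] 0) (𝓝 0) := by
    refine Tendsto.mono_left ?_ nhdsWithin_le_nhds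
    simpa using (continuous_mul_const (2 * t * Real.exp (μ * T) * B x)).tendsto (0 : ℝ)
  have h0 := ge_of_tendsto hlim (eventually_nhdsWithin_of_forall fun η hη => hsmall η hη)
  exact sub_eq_zero.1 (abs_nonpos_iff.1 h0)

end Duhamel

/-- variation-of-constants formula. Under Hypotheses (H), with `θ ∈ (0,1)`,
`f ∈ C^{2+θ}_b(ℝ^N)`, `g ∈ C^{0,θ}([0,T] × ℝ^N)`: if `u` is the bounded classical solution of
`D_t u = 𝒜 u + g`, `u(0,·)=f`; `w` the bounded classical solution of `D_t w = 𝒜 w`,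
`w(0,·)=f`; and for each `r ∈ [0,T)`, `v^{(r)}` the bounded classical solution on `[r,T]` of
`D_t v = 𝒜 v`, `v(r,·) = g(r,·)`; then `u(t,x) = w(t,x) + ∫₀ᵗ v^{(r)}(t,x) dr`. -/
theorem variation_of_constants {N : ℕ} {T : ℝ} {q : ℝ → ES N → Fin N → Fin N → ℝ}
    {b : ℝ → ES N → Fin N → ℝ} {c : ℝ → ES N → ℝ} (H : Hyp N T q b c)
    (θ : ℝ) (hθ : θ ∈ Ioo (0:ℝ) 1) (f : ES N → ℝ) (g : ℝ → ES N → ℝ)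
    (hf : MemCb (2 + θ) f)
    (hg_cont : ContinuousOn (fun p : ℝ × ES N => g p.1 p.2) (Icc (0:ℝ) T ×ˢ univ))
    (hg_mem : ∀ t ∈ Icc (0:ℝ) T, MemCb θ (g t))
    (hg_sup : (⨆ t ∈ Icc (0:ℝ) T, CbNorm θ (g t)) ≠ ⊤)
    (u : ℝ → ES N → ℝ) (hu : IsBCSolInhom q b c T f g u)
    (w : ℝ → ES N → ℝ) (hw : IsBCSol q b c 0 T f w)
    (v : ℝ → ℝ → ES N → ℝ) (hv : ∀ r ∈ Ico (0:ℝ) T, IsBCSol q b c r T (g r) (v r)) :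
    ∀ t ∈ Icc (0:ℝ) T, ∀ x, u t x = w t x + ∫ r in (0:ℝ)..t, v r t x := by
  obtain ⟨μ, B, hB⟩ := H.exists_isBarrier
  obtain ⟨G, hG0, hG⟩ := exists_bound_of_iSup_CbNorm hg_sup
  intro t ht x
  have hz : IsSol q b c 0 T g (fun t x => u t x - w t x) := by
    convert hu.isSol.comb hw.isSol 1 (-1) 0 using 3 with t x t x <;> ring
  have hz₀ : ∀ x, u 0 x - w 0 x = 0 := fun x => by
    rw [hu.2.2.2.2.2.2.2 x, hw.2.2.2.2.2.2.2.2 x, sub_self]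
  have h := hz.eq_integral H hB hg_cont hG0 hG (fun r hr => (hv r hr).isSol)
    (fun r hr => (hv r hr).2.2.2.2.2.2.2.2) hz₀ ht x
  exact sub_eq_iff_eq_add'.1 h
end
end

section
/- Assume Hypotheses (H′). Let f ∈ C²_b(ℝ^N) with f ≤ 0, and let g : [0,T]×ℝ^N → ℝ be bounded and measurable with g(t,·) continuous on ℝ^N for every t ∈ [0,T] and g ≤ 0. If u is a solution of the Cauchy problem D_t u = 𝒜u + g on [0,T]×ℝ^N, u(0,·) = f, in the sense of Definition (S), then u ≤ 0 on [0,T]×ℝ^N. -/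
open Set Filter MeasureTheory Metric
open scoped Topology ENNReal NNReal Classical

noncomputable section

/-- Membership in `M^{0,3+δ}([0,T] × ℝ^N)`: `f` is measurable, `f(t,·) ∈ C^{3+δ}(B(0,R))` for
every `t ∈ [0,T]` and `R > 0`, with `C^{3+δ}(B(0,R))`-norms bounded uniformly in `t`. -/
def MemM03δ {N : ℕ} (T δ : ℝ) (f : ℝ → ES N → ℝ) : Prop :=
  Measurable (fun p : ℝ × ES N => f p.1 p.2) ∧
  (∀ t ∈ Icc (0:ℝ) T, ContDiff ℝ 3 (f t)) ∧
  ∀ R > (0:ℝ), ∃ K : ℝ, ∀ t ∈ Icc (0:ℝ) T, ∀ x ∈ closedBall (0 : ES N) R,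
    |f t x| ≤ K ∧ (∀ k, |pd1 (f t) k x| ≤ K) ∧ (∀ k l, |pd2 (f t) k l x| ≤ K) ∧
    (∀ k l m, |pd3 (f t) k l m x| ≤ K) ∧
    (∀ y ∈ closedBall (0 : ES N) R, ∀ k l m,
      |pd3 (f t) k l m x - pd3 (f t) k l m y| ≤ K * ‖x - y‖ ^ δ)

/-- Hypotheses (H′) of Section 3 of the paper: coefficients measurable in time, in
`M^{0,3+δ}([0,T] × ℝ^N)`, satisfying Hypotheses (H)(ii)–(vii) for `t` in a set `𝒟` with
negligible complement in `[0,T]`, with `d(·,x)`, `r(·,x)`, `ϱ(·,x)` bounded and measurable. -/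
structure Hyp' (N : ℕ) (T : ℝ) (q : ℝ → ES N → Fin N → Fin N → ℝ)
    (b : ℝ → ES N → Fin N → ℝ) (c : ℝ → ES N → ℝ) where
  T_pos : 0 < T
  N_pos : 1 ≤ N
  /- (i) regularity. -/
  δ : ℝ
  δ_mem : δ ∈ Ioo (0:ℝ) 1
  mem_q : ∀ i j, MemM03δ T δ fun t x => q t x i j
  mem_b : ∀ j, MemM03δ T δ fun t x => b t x j
  mem_c : MemM03δ T δ c
  q_symm : ∀ t ∈ Icc (0:ℝ) T, ∀ x i j, q t x i j = q t x j i
  /- the set `𝒟` of "good" times. -/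
  𝒟 : Set ℝ
  𝒟_meas : MeasurableSet 𝒟
  𝒟_sub : 𝒟 ⊆ Icc (0:ℝ) T
  𝒟_ae : volume (Icc (0:ℝ) T \ 𝒟) = 0
  /- (ii) ellipticity. -/
  ν : ℝ → ES N → ℝ
  ν₀ : ℝ
  ν₀_pos : 0 < ν₀
  ν_lb : ∀ t ∈ 𝒟, ∀ x, ν₀ ≤ ν t x
  ellip : ∀ t ∈ 𝒟, ∀ x, ∀ ξ : ES N, ν t x * ‖ξ‖ ^ 2 ≤ ∑ i, ∑ j, q t x i j * ξ i * ξ j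
  /- (iii) growth conditions. -/
  C₁ : ℝ
  C₂ : ℝ
  C₃ : ℝ
  C₁_pos : 0 < C₁
  C₂_pos : 0 < C₂
  C₃_pos : 0 < C₃
  growth_Q : ∀ t ∈ 𝒟, ∀ x,
    ‖(EuclideanSpace.equiv (Fin N) ℝ).symm fun i => ∑ j, q t x i j * x j‖
      ≤ C₁ * (1 + ‖x‖ ^ 2) * ν t x
  growth_tr : ∀ t ∈ 𝒟, ∀ x, (∑ i, q t x i i) ≤ C₂ * (1 + ‖x‖ ^ 2) * ν t x
  growth_b : ∀ t ∈ 𝒟, ∀ x, (∑ j, b t x j * x j) ≤ C₃ * (1 + ‖x‖ ^ 2) * ν t x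
  /- (iv) `c` is bounded from above. -/
  c₀ : ℝ
  c_ub : ∀ t ∈ 𝒟, ∀ x, c t x ≤ c₀
  /- (v) bounds on the derivatives of the diffusion coefficients. -/
  K₁ : ℝ
  K₂ : ℝ
  K₃ : ℝ
  K₁_pos : 0 < K₁
  K₂_pos : 0 < K₂
  K₃_pos : 0 < K₃
  dq1_bound : ∀ t ∈ 𝒟, ∀ x i j k, |pd1 (fun y => q t y i j) k x| ≤ K₁ * ν t x
  dq3_bound : ∀ t ∈ 𝒟, ∀ x i j k l m, |pd3 (fun y => q t y i j) k l m x| ≤ K₃ * ν t x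
  dq2_quad : ∀ t ∈ 𝒟, ∀ x, ∀ Ξ : Fin N → Fin N → ℝ, (∀ h k, Ξ h k = Ξ k h) →
    (∑ h, ∑ k, ∑ l, ∑ m, pd2 (fun y => q t y h k) l m x * Ξ h k * Ξ l m)
      ≤ K₂ * ν t x * ∑ h, ∑ k, Ξ h k ^ 2
  /- (vi) dissipativity and bounds on the derivatives of the drift and of `c`. -/
  d : ℝ → ES N → ℝ
  r : ℝ → ES N → ℝ
  ϱ : ℝ → ES N → ℝ
  ϱ₀ : ℝ
  ϱ₀_pos : 0 < ϱ₀
  ϱ_lb : ∀ t ∈ 𝒟, ∀ x, ϱ₀ ≤ ϱ t x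
  L₁ : ℝ
  L₂ : ℝ
  L₃ : ℝ
  L₁_pos : 0 < L₁
  L₂_pos : 0 < L₂
  L₃_pos : 0 < L₃
  dissip : ∀ t ∈ 𝒟, ∀ x, ∀ ξ : ES N,
    (∑ i, ∑ j, pd1 (fun y => b t y i) j x * ξ j * ξ i) ≤ d t x * ‖ξ‖ ^ 2
  db2_bound : ∀ t ∈ 𝒟, ∀ x j k l, |pd2 (fun y => b t y j) k l x| ≤ r t x
  db3_bound : ∀ t ∈ 𝒟, ∀ x j k l m, |pd3 (fun y => b t y j) k l m x| ≤ r t x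
  dc1_bound : ∀ t ∈ 𝒟, ∀ x k, |pd1 (c t) k x| ≤ ϱ t x
  dc2_bound : ∀ t ∈ 𝒟, ∀ x k l, |pd2 (c t) k l x| ≤ ϱ t x
  dc3_bound : ∀ t ∈ 𝒟, ∀ x k l m, |pd3 (c t) k l m x| ≤ ϱ t x
  funz : ∀ t ∈ 𝒟, ∀ x, d t x + L₁ * r t x + L₂ * ϱ t x ^ 2 ≤ L₃ * ν t x
  /- (vii) existence of a Lyapunov function. -/
  liap : ∃ φ : ES N → ℝ, ∃ lam : ℝ, 0 < lam ∧ (∀ x, 0 < φ x) ∧ ContDiff ℝ 2 φ ∧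
    Tendsto φ (cocompact (ES N)) atTop ∧
    ∃ M : ℝ, ∀ t ∈ 𝒟, ∀ x, Aop q b c φ t x - lam * φ x ≤ M
  /- boundedness and measurability in time of `d`, `r`, `ϱ`. -/
  d_meas : ∀ x, Measurable fun t => d t x
  d_bdd : ∀ x, ∃ M, ∀ t ∈ Ioo (0:ℝ) T, |d t x| ≤ M
  r_meas : ∀ x, Measurable fun t => r t x
  r_bdd : ∀ x, ∃ M, ∀ t ∈ Ioo (0:ℝ) T, |r t x| ≤ M
  ϱ_meas : ∀ x, Measurable fun t => ϱ t x
  ϱ_bdd : ∀ x, ∃ M, ∀ t ∈ Ioo (0:ℝ) T, |ϱ t x| ≤ M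

/-- Definition (S) (Definition `defin-1` of the paper): `u` is a solution of the Cauchy problem
`D_t u = 𝒜 u + g` on `[0,T] × ℝ^N`, `u(0,·) = f`, adapted to coefficients which are merely
measurable in time. -/
def IsSolS {N : ℕ} (q : ℝ → ES N → Fin N → Fin N → ℝ) (b : ℝ → ES N → Fin N → ℝ)
    (c : ℝ → ES N → ℝ) (T : ℝ) (f : ES N → ℝ) (g : ℝ → ES N → ℝ)
    (u : ℝ → ES N → ℝ) : Prop :=
  -- `u` is bounded
  (∃ M, ∀ t ∈ Icc (0:ℝ) T, ∀ x, |u t x| ≤ M) ∧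
  -- (i) `u` is Lipschitz continuous on `[0,T] × closure(B(0,R))` for every `R > 0`
  (∀ R > (0:ℝ), ∃ L : ℝ≥0,
    LipschitzOnWith L (fun p : ℝ × ES N => u p.1 p.2) (Icc (0:ℝ) T ×ˢ closedBall 0 R)) ∧
  -- (i) `u(t,·)` is twice continuously differentiable
  (∀ t ∈ Icc (0:ℝ) T, ContDiff ℝ 2 (u t)) ∧
  -- (i) the first- and second-order spatial derivatives are bounded …
  (∃ M, ∀ t ∈ Icc (0:ℝ) T, ∀ x,
    (∀ i, |pd1 (u t) i x| ≤ M) ∧ (∀ i j, |pd2 (u t) i j x| ≤ M)) ∧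
  -- … and continuous on `[0,T] × ℝ^N`
  (∀ i, ContinuousOn (fun p : ℝ × ES N => pd1 (u p.1) i p.2) (Icc (0:ℝ) T ×ˢ univ)) ∧
  (∀ i j, ContinuousOn (fun p : ℝ × ES N => pd2 (u p.1) i j p.2) (Icc (0:ℝ) T ×ˢ univ)) ∧
  -- (ii) the initial condition
  (∀ x, u 0 x = f x) ∧
  -- (iii) the equation holds on a set `G` with negligible complement, all of whose sections
  -- are measurable with measure `T`
  (∃ G : Set (ℝ × ES N), G ⊆ Icc (0:ℝ) T ×ˢ univ ∧
    volume ((Icc (0:ℝ) T ×ˢ (univ : Set (ES N))) \ G) = 0 ∧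
    (∀ p ∈ G, HasDerivAt (fun t' => u t' p.2)
      (Aop q b c (u p.1) p.1 p.2 + g p.1 p.2) p.1) ∧
    (∀ x : ES N, MeasurableSet {t : ℝ | (t, x) ∈ G} ∧
      volume {t : ℝ | (t, x) ∈ G} = ENNReal.ofReal T))

/-- An absolutely continuous function whose derivative is a.e. bounded above by `-θ` decreases
at rate at least `θ`. -/
theorem AbsolutelyContinuousOnInterval.le_sub_of_ae_deriv_le {w : ℝ → ℝ} {a b θ : ℝ}
    (hab : a ≤ b) (hac : AbsolutelyContinuousOnInterval w a b)
    (hd : ∀ᵐ t, t ∈ Ioo a b → deriv w t ≤ -θ) : w b ≤ w a - θ * (b - a) := by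
  have hle : ∫ t in a..b, deriv w t ≤ ∫ _ in a..b, -θ := by
    refine intervalIntegral.integral_mono_ae_restrict hab hac.intervalIntegrable_deriv
      intervalIntegrable_const ?_
    rw [← restrict_Ioo_eq_restrict_Icc]
    exact (ae_restrict_iff' measurableSet_Ioo).2 hd
  rw [hac.integral_deriv_eq_sub, intervalIntegral.integral_const, smul_eq_mul] at hle
  linarith

/-- The second derivative of a real function is nonpositive at a local maximum. -/
theorem IsLocalMax.deriv_deriv_nonpos {w : ℝ → ℝ} {a : ℝ} (h : IsLocalMax w a)
    (hc : ContinuousAt w a) : deriv (deriv w) a ≤ 0 := by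
  by_contra! hpos
  have hmin := isLocalMin_of_deriv_deriv_pos hpos h.deriv_eq_zero hc
  have hconst : w =ᶠ[𝓝 a] fun _ => w a := by
    filter_upwards [h, hmin] with s h₁ h₂ using le_antisymm h₁ h₂
  have hd : deriv (deriv w) a = 0 := by
    rw [hconst.deriv.deriv_eq]
    simp
  linarith

theorem ContDiff.pd1 {N : ℕ} {V : ES N → ℝ} {m n : WithTop ℕ∞} (hV : ContDiff ℝ n V)
    (hmn : m + 1 ≤ n) (i : Fin N) : ContDiff ℝ m (_root_.pd1 V i) :=
  (hV.fderiv_right hmn).clm_apply contDiff_const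

theorem pd1_sub_const_mul {N : ℕ} {V W : ES N → ℝ} (hV : Differentiable ℝ V)
    (hW : Differentiable ℝ W) (a e : ℝ) (i : Fin N) :
    pd1 (fun x => a * V x - e * W x) i = fun x => a * pd1 V i x - e * pd1 W i x := by
  funext x
  simp only [pd1]
  rw [fderiv_fun_sub ((hV x).const_mul a) ((hW x).const_mul e), fderiv_const_mul (hV x),
    fderiv_const_mul (hW x)]
  rfl

theorem pd2_sub_const_mul {N : ℕ} {V W : ES N → ℝ} (hV : ContDiff ℝ 2 V)
    (hW : ContDiff ℝ 2 W) (a e : ℝ) (i j : Fin N) :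
    pd2 (fun x => a * V x - e * W x) i j = fun x => a * pd2 V i j x - e * pd2 W i j x := by
  simp only [pd2]
  rw [pd1_sub_const_mul (hV.differentiable two_ne_zero) (hW.differentiable two_ne_zero),
    pd1_sub_const_mul ((hV.pd1 (m := 1) (by norm_num) j).differentiable one_ne_zero)
      ((hW.pd1 (m := 1) (by norm_num) j).differentiable one_ne_zero)]

theorem hasDerivAt_comp_line {N : ℕ} {V : ES N → ℝ} (hV : Differentiable ℝ V) (x ξ : ES N)
    (s : ℝ) : HasDerivAt (fun s : ℝ => V (x + s • ξ)) (∑ i, ξ i * pd1 V i (x + s • ξ)) s := by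
  have hline : HasDerivAt (fun s : ℝ => x + s • ξ) ξ s := by
    simpa using ((hasDerivAt_id s).smul_const ξ).const_add x
  have hξ : ∑ i, ξ i • EuclideanSpace.single i (1 : ℝ) = ξ := by
    simpa using (EuclideanSpace.basisFun (Fin N) ℝ).sum_repr ξ
  have hsum : ∑ i, ξ i * pd1 V i (x + s • ξ) = fderiv ℝ V (x + s • ξ) ξ := by
    refine Eq.trans ?_ (congrArg (fderiv ℝ V (x + s • ξ)) hξ)
    simp [pd1]
  rw [hsum]
  exact (hV (x + s • ξ)).hasFDerivAt.comp_hasDerivAt s hline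

/-- The Hessian of a `C²` function is negative semidefinite at a local maximum. -/
theorem IsLocalMax.sum_pd2_nonpos {N : ℕ} {V : ES N → ℝ} (hV : ContDiff ℝ 2 V) {x : ES N}
    (h : IsLocalMax V x) (ξ : Fin N → ℝ) : ∑ i, ∑ j, pd2 V i j x * ξ i * ξ j ≤ 0 := by
  let η : ES N := WithLp.toLp 2 ξ
  have hVd := hV.differentiable two_ne_zero
  have hcont : ContinuousAt (fun s : ℝ => x + s • η) 0 := by fun_prop
  have hmax : IsLocalMax (fun s : ℝ => V (x + s • η)) 0 := by
    have : Tendsto (fun s : ℝ => x + s • η) (𝓝 0) (𝓝 x) := by simpa using hcont.tendsto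
    simpa [IsLocalMax, IsMaxFilter] using this.eventually h
  have hd : deriv (fun s : ℝ => V (x + s • η)) = fun s => ∑ j, η j * pd1 V j (x + s • η) :=
    funext fun s => (hasDerivAt_comp_line hVd x η s).deriv
  have hdd : HasDerivAt (fun s : ℝ => ∑ j, η j * pd1 V j (x + s • η))
      (∑ j, η j * ∑ i, η i * pd1 (pd1 V j) i (x + (0 : ℝ) • η)) 0 :=
    HasDerivAt.fun_sum fun j _ => (hasDerivAt_comp_line
      ((hV.pd1 (m := 1) (by norm_num) j).differentiable one_ne_zero) x η 0).const_mul _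
  have hle := hmax.deriv_deriv_nonpos (hasDerivAt_comp_line hVd x η 0).continuousAt
  rw [hd, hdd.deriv] at hle
  rw [Finset.sum_comm]
  refine le_of_eq_of_le ?_ hle
  refine Finset.sum_congr rfl fun j _ => ?_
  rw [Finset.mul_sum]
  refine Finset.sum_congr rfl fun i _ => ?_
  simp only [zero_smul, add_zero, pd2, η]
  ring

/-- The trace of the product of a positive semidefinite symmetric matrix and a negative
semidefinite one is nonpositive. -/
theorem sum_mul_nonpos_of_psd_of_nsd {n : Type*} [Fintype n] {A B : n → n → ℝ}
    (hsymm : ∀ i j, A i j = A j i) (hA : ∀ ξ : n → ℝ, 0 ≤ ∑ i, ∑ j, A i j * ξ i * ξ j)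
    (hB : ∀ ξ : n → ℝ, ∑ i, ∑ j, B i j * ξ i * ξ j ≤ 0) : ∑ i, ∑ j, A i j * B i j ≤ 0 := by
  have hpsd : (Matrix.of A).PosSemidef := by
    refine .of_dotProduct_mulVec_nonneg (Matrix.IsHermitian.ext fun i j => hsymm j i) fun ξ => ?_
    refine (hA ξ).trans_eq (Finset.sum_congr rfl fun i _ => ?_)
    simp only [Matrix.mulVec, dotProduct, Finset.mul_sum, star_trivial, Pi.star_apply,
      Matrix.of_apply]
    exact Finset.sum_congr rfl fun j _ => by ring
  obtain ⟨m, v, hv⟩ := Matrix.posSemidef_iff_eq_sum_vecMulVec.1 hpsd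
  have hAv : ∀ i j, A i j = ∑ k, v k i * v k j := fun i j => by
    simpa [Matrix.sum_apply, Matrix.vecMulVec_apply] using congrFun₂ hv i j
  calc ∑ i, ∑ j, A i j * B i j = ∑ k, ∑ i, ∑ j, B i j * v k i * v k j := by
        simp only [hAv, Finset.sum_mul]
        rw [Finset.sum_comm]
        conv_rhs => rw [Finset.sum_comm]
        rw [Finset.sum_comm]
        refine Finset.sum_congr rfl fun i _ => ?_
        rw [Finset.sum_comm]
        exact Finset.sum_congr rfl fun k _ => Finset.sum_congr rfl fun j _ => by ring
    _ ≤ 0 := Finset.sum_nonpos fun k _ => hB (v k)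

theorem MemM03δ.exists_bound {N : ℕ} {T δ : ℝ} {h : ℝ → ES N → ℝ} (hh : MemM03δ T δ h)
    (x : ES N) : ∃ K, ∀ t ∈ Icc (0 : ℝ) T, |h t x| ≤ K := by
  obtain ⟨K, hK⟩ := hh.2.2 (‖x‖ + 1) (by positivity)
  exact ⟨K, fun t ht => (hK t ht x (by simp)).1⟩

theorem Aop_sub_const_mul {N : ℕ} (q : ℝ → ES N → Fin N → Fin N → ℝ)
    (b : ℝ → ES N → Fin N → ℝ) (c : ℝ → ES N → ℝ) {V W : ES N → ℝ} (hV : ContDiff ℝ 2 V)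
    (hW : ContDiff ℝ 2 W) (a e t : ℝ) (x : ES N) :
    Aop q b c (fun y => a * V y - e * W y) t x = a * Aop q b c V t x - e * Aop q b c W t x := by
  simp only [Aop, pd2_sub_const_mul hV hW, mul_add, Finset.mul_sum,
    pd1_sub_const_mul (hV.differentiable two_ne_zero) (hW.differentiable two_ne_zero),
    mul_sub, Finset.sum_sub_distrib, mul_left_comm]
  ring

/-- If `Q` and `β` are eventually bounded, `A → A₀` and `p → 0`, then `⟨Q, A⟩ + ⟨β, p⟩` is
eventually below any positive threshold wherever `⟨Q, A₀⟩ ≤ 0`. -/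
theorem eventually_principal_part_lt {n α : Type*} [Fintype n] {l : Filter α}
    {Q A : α → n → n → ℝ} {β p : α → n → ℝ} {A₀ : n → n → ℝ}
    (hQ : ∀ i j, ∃ K, ∀ᶠ t in l, |Q t i j| ≤ K) (hβ : ∀ j, ∃ K, ∀ᶠ t in l, |β t j| ≤ K)
    (hA : ∀ i j, Tendsto (fun t => A t i j) l (𝓝 (A₀ i j)))
    (hp : ∀ j, Tendsto (fun t => p t j) l (𝓝 0)) {θ : ℝ} (hθ : 0 < θ) :
    ∀ᶠ t in l, ∑ i, ∑ j, Q t i j * A₀ i j ≤ 0 →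
      (∑ i, ∑ j, Q t i j * A t i j) + ∑ j, β t j * p t j < θ := by
  have h₁ : Tendsto (fun t => ∑ i, ∑ j, Q t i j * (A t i j - A₀ i j)) l (𝓝 0) := by
    rw [show (0 : ℝ) = ∑ _i : n, ∑ _j : n, 0 by simp]
    refine tendsto_finsetSum _ fun i _ => tendsto_finsetSum _ fun j _ => ?_
    obtain ⟨K, hK⟩ := hQ i j
    exact bdd_le_mul_tendsto_zero' K hK (by simpa using (hA i j).sub_const (A₀ i j))
  have h₂ : Tendsto (fun t => ∑ j, β t j * p t j) l (𝓝 0) := by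
    rw [show (0 : ℝ) = ∑ _j : n, 0 by simp]
    refine tendsto_finsetSum _ fun j _ => ?_
    obtain ⟨K, hK⟩ := hβ j
    exact bdd_le_mul_tendsto_zero' K hK (hp j)
  have h := h₁.add h₂
  rw [add_zero] at h
  filter_upwards [h.eventually_lt_const hθ] with t ht hle
  simp only [mul_sub, Finset.sum_sub_distrib] at ht
  linarith

/-- A positive maximum of `e^{-κt} u - ε φ` over `[0,T] × ℝ^N` cannot be attained at a positive
time, when `φ` is a strict supersolution for `𝒜 - κ`. -/
theorem IsSolS.not_isMax_of_pos {N : ℕ} {T : ℝ} {q : ℝ → ES N → Fin N → Fin N → ℝ}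
    {b : ℝ → ES N → Fin N → ℝ} {c : ℝ → ES N → ℝ} (H : Hyp' N T q b c) {f : ES N → ℝ}
    {g : ℝ → ES N → ℝ} {u : ℝ → ES N → ℝ} (hu : IsSolS q b c T f g u)
    (hg_le : ∀ t ∈ Icc (0 : ℝ) T, ∀ x, g t x ≤ 0) {φ : ES N → ℝ} (hφ : ContDiff ℝ 2 φ)
    (hφ_pos : ∀ x, 0 < φ x) {κ ε : ℝ} (hε : 0 < ε) (hcκ : H.c₀ ≤ κ)
    (hsuper : ∀ t ∈ H.𝒟, ∀ x, Aop q b c φ t x ≤ (κ - 1) * φ x) {t₀ : ℝ} {x₀ : ES N}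
    (ht₀ : t₀ ∈ Ioc (0 : ℝ) T) (hpos : 0 < Real.exp (-κ * t₀) * u t₀ x₀ - ε * φ x₀) :
    ¬ ∀ t ∈ Icc (0 : ℝ) T, ∀ x,
      Real.exp (-κ * t) * u t x - ε * φ x ≤ Real.exp (-κ * t₀) * u t₀ x₀ - ε * φ x₀ := by
  intro hmax
  obtain ⟨-, hlip, hC2, -, hcont1, hcont2, -, G, hGsub, -, hGder, hGsec⟩ := hu
  have ht₀' : t₀ ∈ Icc (0 : ℝ) T := Ioc_subset_Icc_self ht₀
  set v : ℝ → ES N → ℝ := fun t x => Real.exp (-κ * t) * u t x - ε * φ x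
  have hslice : ContinuousOn (fun t : ℝ => (t, x₀)) (Icc 0 T) := by fun_prop
  have hmaps : MapsTo (fun t : ℝ => (t, x₀)) (Icc 0 T) (Icc 0 T ×ˢ univ) := fun t ht => by
    simpa using ht
  have hexp : Continuous fun t : ℝ => Real.exp (-κ * t) := by fun_prop
  have hC2v : ContDiff ℝ 2 (v t₀) :=
    (contDiff_const.mul (hC2 t₀ ht₀')).sub (contDiff_const.mul hφ)
  have hlocmax : IsLocalMax (v t₀) x₀ := Eventually.of_forall fun y => hmax t₀ ht₀' y
  have hpd1 : ∀ j, Tendsto (fun t => pd1 (v t) j x₀) (𝓝[Icc 0 T] t₀) (𝓝 0) := by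
    intro j
    have hzero : pd1 (v t₀) j x₀ = 0 := by simp [pd1, hlocmax.fderiv_eq_zero]
    have hc : ContinuousOn (fun t => pd1 (v t) j x₀) (Icc 0 T) := by
      have := (hexp.continuousOn.mul ((hcont1 j).comp hslice hmaps)).sub
        (continuousOn_const (c := ε * pd1 φ j x₀))
      refine this.congr fun t ht => ?_
      exact congrFun (pd1_sub_const_mul ((hC2 t ht).differentiable two_ne_zero)
        (hφ.differentiable two_ne_zero) _ _ j) x₀
    simpa only [ContinuousWithinAt, hzero] using hc t₀ ht₀'
  have hpd2 : ∀ i j, Tendsto (fun t => pd2 (v t) i j x₀) (𝓝[Icc 0 T] t₀)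
      (𝓝 (pd2 (v t₀) i j x₀)) := by
    intro i j
    have hc : ContinuousOn (fun t => pd2 (v t) i j x₀) (Icc 0 T) := by
      have := (hexp.continuousOn.mul ((hcont2 i j).comp hslice hmaps)).sub
        (continuousOn_const (c := ε * pd2 φ i j x₀))
      refine this.congr fun t ht => ?_
      exact congrFun (pd2_sub_const_mul (hC2 t ht) hφ _ _ i j) x₀
    exact hc t₀ ht₀'
  obtain ⟨L, hL⟩ := hlip (‖x₀‖ + 1) (by positivity)
  have hulip : LipschitzOnWith L (fun t => u t x₀) (Icc 0 T) := by
    intro s hs t ht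
    simpa [Prod.edist_eq] using
      hL (show (s, x₀) ∈ Icc 0 T ×ˢ closedBall 0 (‖x₀‖ + 1) from ⟨hs, by simp⟩)
        (show (t, x₀) ∈ Icc 0 T ×ˢ closedBall 0 (‖x₀‖ + 1) from ⟨ht, by simp⟩)
  have hvcont : ContinuousOn (fun t => v t x₀) (Icc 0 T) :=
    (hexp.continuousOn.mul hulip.continuousOn).sub continuousOn_const
  have hθ : 0 < ε * φ x₀ / 2 := by have := hφ_pos x₀; positivity
  have hprinc := eventually_principal_part_lt (l := 𝓝[Icc 0 T] t₀) (Q := fun t => q t x₀)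
    (β := fun t => b t x₀) (A := fun t i j => pd2 (v t) i j x₀)
    (p := fun t j => pd1 (v t) j x₀)
    (fun i j => ((H.mem_q i j).exists_bound x₀).imp fun K hK =>
      eventually_nhdsWithin_of_forall hK)
    (fun j => ((H.mem_b j).exists_bound x₀).imp fun K hK =>
      eventually_nhdsWithin_of_forall hK) hpd2 hpd1 hθ
  have hfilter : 𝓝[<] t₀ ≤ 𝓝[Icc 0 T] t₀ := by
    rw [← nhdsWithin_Ioo_eq_nhdsLT ht₀.1]
    exact nhdsWithin_mono _ fun t ht => ⟨ht.1.le, ht.2.le.trans ht₀.2⟩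
  obtain ⟨s, hs, hsub⟩ := (mem_nhdsLT_iff_exists_mem_Ico_Ioo_subset ht₀.1).1
    (hfilter (hprinc.and ((hvcont t₀ ht₀').eventually_const_lt hpos)))
  have hIcc : uIcc s t₀ ⊆ Icc 0 T := by
    rw [uIcc_of_le hs.2.le]
    exact Icc_subset_Icc hs.1 ht₀.2
  have hac : AbsolutelyContinuousOnInterval (fun t => v t x₀) s t₀ := by
    have hexp_ac : AbsolutelyContinuousOnInterval (fun t => Real.exp (-κ * t)) s t₀ :=
      ContDiffOn.absolutelyContinuousOnInterval (by fun_prop)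
    have hconst_ac : AbsolutelyContinuousOnInterval (fun _ : ℝ => ε * φ x₀) s t₀ :=
      ContDiffOn.absolutelyContinuousOnInterval contDiffOn_const
    exact (hexp_ac.mul (hulip.mono hIcc).absolutelyContinuousOnInterval).sub hconst_ac
  have hGae : ∀ᵐ t, t ∈ Icc 0 T → (t, x₀) ∈ G := by
    have hnull : volume (Icc 0 T \ {t : ℝ | (t, x₀) ∈ G}) = 0 := by
      rw [measure_sdiff (s₂ := {t : ℝ | (t, x₀) ∈ G}) (fun t ht => (hGsub ht).1)
        (hGsec x₀).1.nullMeasurableSet (by simp [(hGsec x₀).2]), (hGsec x₀).2,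
        Real.volume_Icc, sub_zero, tsub_self]
    filter_upwards [compl_mem_ae_iff.2 hnull] with t ht h
    by_contra hn
    exact ht ⟨h, hn⟩
  have hDae : ∀ᵐ t, t ∈ Icc 0 T → t ∈ H.𝒟 := by
    filter_upwards [compl_mem_ae_iff.2 H.𝒟_ae] with t ht h
    by_contra hn
    exact ht ⟨h, hn⟩
  have hdecr : v t₀ x₀ ≤ v s x₀ - ε * φ x₀ / 2 * (t₀ - s) := by
    refine hac.le_sub_of_ae_deriv_le hs.2.le ?_
    filter_upwards [hGae, hDae] with t htG htD ht
    have htI : t ∈ Icc 0 T := hIcc (by rw [uIcc_of_le hs.2.le]; exact Ioo_subset_Icc_self ht)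
    have htD := htD htI
    obtain ⟨hP, hvpos⟩ := hsub ht
    have hP := hP <| sum_mul_nonpos_of_psd_of_nsd (H.q_symm t htI x₀)
      (fun ξ => le_trans (mul_nonneg (H.ν₀_pos.le.trans (H.ν_lb t htD x₀)) (sq_nonneg _))
        (H.ellip t htD x₀ (WithLp.toLp 2 ξ)))
      (hlocmax.sum_pd2_nonpos hC2v)
    have hexp_der : HasDerivAt (fun t => Real.exp (-κ * t)) (Real.exp (-κ * t) * -κ) t := by
      simpa using ((hasDerivAt_id t).const_mul (-κ)).exp
    have hder : HasDerivAt (fun t => v t x₀) (Real.exp (-κ * t) * -κ * u t x₀ +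
        Real.exp (-κ * t) * (Aop q b c (u t) t x₀ + g t x₀)) t :=
      (hexp_der.mul (hGder (t, x₀) (htG htI))).sub_const _
    rw [hder.deriv]
    have hA : Aop q b c (v t) t x₀ =
        Real.exp (-κ * t) * Aop q b c (u t) t x₀ - ε * Aop q b c φ t x₀ :=
      Aop_sub_const_mul q b c (hC2 t htI) hφ _ _ _ _
    have hA' : Aop q b c (v t) t x₀ < ε * φ x₀ / 2 + c t x₀ * v t x₀ := by
      unfold Aop
      linarith
    have hcv : c t x₀ * v t x₀ ≤ κ * v t x₀ :=
      mul_le_mul_of_nonneg_right ((H.c_ub t htD x₀).trans hcκ) (le_of_lt hvpos)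
    have hvt : v t x₀ = Real.exp (-κ * t) * u t x₀ - ε * φ x₀ := rfl
    have hφA := mul_le_mul_of_nonneg_left (hsuper t htD x₀) hε.le
    have hge := mul_nonpos_of_nonneg_of_nonpos (Real.exp_pos (-κ * t)).le (hg_le t htI x₀)
    rw [hvt] at hcv hA'
    linarith
  have hle := hmax s (hIcc left_mem_uIcc) x₀
  have : 0 < ε * φ x₀ / 2 * (t₀ - s) := mul_pos hθ (sub_pos.2 hs.2)
  linarith

/-- Proposition `maxprinc` of the paper. Under Hypotheses (H′), if
`f ∈ C²_b(ℝ^N)` with `f ≤ 0`, `g` is bounded and measurable with `g(t,·)` continuous for every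
`t ∈ [0,T]` and `g ≤ 0`, and `u` solves `D_t u = 𝒜 u + g`, `u(0,·) = f` in the sense of
Definition (S), then `u ≤ 0` on `[0,T] × ℝ^N`. -/
theorem maximum_principle_measurable {N : ℕ} {T : ℝ} {q : ℝ → ES N → Fin N → Fin N → ℝ}
    {b : ℝ → ES N → Fin N → ℝ} {c : ℝ → ES N → ℝ} (H : Hyp' N T q b c)
    (f : ES N → ℝ) (hf_smooth : ContDiff ℝ 2 f)
    (hf_bdd : ∃ M, ∀ x, |f x| ≤ M ∧ (∀ i, |pd1 f i x| ≤ M) ∧ (∀ i j, |pd2 f i j x| ≤ M))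
    (hf_le : ∀ x, f x ≤ 0)
    (g : ℝ → ES N → ℝ) (hg_meas : Measurable fun p : ℝ × ES N => g p.1 p.2)
    (hg_bdd : ∃ M, ∀ t ∈ Icc (0:ℝ) T, ∀ x, |g t x| ≤ M)
    (hg_cont : ∀ t ∈ Icc (0:ℝ) T, Continuous (g t))
    (hg_le : ∀ t ∈ Icc (0:ℝ) T, ∀ x, g t x ≤ 0)
    (u : ℝ → ES N → ℝ) (hu : IsSolS q b c T f g u) :
    ∀ t ∈ Icc (0:ℝ) T, ∀ x, u t x ≤ 0 := by
  obtain ⟨φ, lam, hlam, hφ_pos, hφ, hφ_top, M, hM⟩ := H.liap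
  obtain ⟨Mu, hMu⟩ := hu.1
  obtain ⟨z, hz⟩ := hφ.continuous.exists_forall_le hφ_top
  obtain ⟨κ, hcκ, hφκ⟩ : ∃ κ, H.c₀ ≤ κ ∧ lam + |M| / φ z + 1 ≤ κ :=
    ⟨_, le_max_left _ _, le_max_right _ _⟩
  have hκ : 0 ≤ κ := by have := div_nonneg (abs_nonneg M) (hφ_pos z).le; linarith
  have hsuper : ∀ t ∈ H.𝒟, ∀ x, Aop q b c φ t x ≤ (κ - 1) * φ x := by
    intro t ht x
    have hMx : M ≤ |M| / φ z * φ x := by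
      rw [div_mul_eq_mul_div, le_div_iff₀ (hφ_pos z)]
      exact mul_le_mul (le_abs_self M) (hz x) (hφ_pos z).le (abs_nonneg M)
    have := mul_le_mul_of_nonneg_right hφκ (hφ_pos x).le
    linarith [hM t ht x]
  have hmain : ∀ ε > (0 : ℝ), ∀ t ∈ Icc (0 : ℝ) T, ∀ x,
      Real.exp (-κ * t) * u t x - ε * φ x ≤ 0 := by
    intro ε hε t₁ ht₁ x₁
    by_contra! hpos₁
    have hfar : {y | Mu / ε < φ y} ∈ cocompact (ES N) := hφ_top.eventually_gt_atTop _
    obtain ⟨R, hR⟩ := closedBall_compl_subset_of_mem_cocompact hfar 0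
    set R' := max (max R ‖x₁‖) 1
    have hR' : 0 < R' := one_pos.trans_le (le_max_right _ _)
    obtain ⟨L, hL⟩ := hu.2.1 R' hR'
    have hcont : ContinuousOn
        (fun p : ℝ × ES N => Real.exp (-κ * p.1) * u p.1 p.2 - ε * φ p.2)
        (Icc 0 T ×ˢ closedBall 0 R') := by
      have hexp : Continuous fun p : ℝ × ES N => Real.exp (-κ * p.1) := by fun_prop
      have hφc : Continuous fun p : ℝ × ES N => ε * φ p.2 :=
        continuous_const.mul (hφ.continuous.comp continuous_snd)
      exact (hexp.continuousOn.mul hL.continuousOn).sub hφc.continuousOn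
    have hmem₁ : (t₁, x₁) ∈ Icc 0 T ×ˢ closedBall (0 : ES N) R' :=
      ⟨ht₁, by simp [R']⟩
    obtain ⟨⟨t₀, x₀⟩, hmem₀, hmax₀⟩ :=
      (isCompact_Icc.prod (isCompact_closedBall 0 R')).exists_isMaxOn ⟨_, hmem₁⟩ hcont
    have hpos₀ : 0 < Real.exp (-κ * t₀) * u t₀ x₀ - ε * φ x₀ :=
      hpos₁.trans_le (hmax₀ hmem₁)
    have hmax : ∀ t ∈ Icc (0 : ℝ) T, ∀ x,
        Real.exp (-κ * t) * u t x - ε * φ x ≤ Real.exp (-κ * t₀) * u t₀ x₀ - ε * φ x₀ := by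
      intro t ht x
      by_cases hx : x ∈ closedBall (0 : ES N) R'
      · exact hmax₀ (show (t, x) ∈ Icc 0 T ×ˢ closedBall (0 : ES N) R' from ⟨ht, hx⟩)
      · have hxR : Mu / ε < φ x := hR fun h => hx
          (closedBall_subset_closedBall ((le_max_left _ _).trans (le_max_left _ _)) h)
        rw [div_lt_iff₀ hε] at hxR
        have hexp : Real.exp (-κ * t) ≤ 1 := by
          rw [Real.exp_le_one_iff]
          nlinarith [ht.1]
        have hbd : Real.exp (-κ * t) * u t x ≤ Mu := by
          refine (mul_le_mul_of_nonneg_left (le_abs_self _) (Real.exp_pos _).le).trans ?_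
          exact (mul_le_of_le_one_left (abs_nonneg _) hexp).trans (hMu t ht x)
        linarith
    have ht₀ : t₀ ≠ 0 := by
      rintro rfl
      have hf₀ := hu.2.2.2.2.2.2.1 x₀
      have := mul_pos hε (hφ_pos x₀)
      rw [mul_zero, Real.exp_zero, one_mul, hf₀] at hpos₀
      linarith [hf_le x₀]
    exact hu.not_isMax_of_pos H hg_le hφ hφ_pos hε hcκ hsuper
      ⟨lt_of_le_of_ne hmem₀.1.1 ht₀.symm, hmem₀.1.2⟩ hpos₀ hmax
  intro t ht x
  have hexp_le : Real.exp (-κ * t) * u t x ≤ 0 := by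
    refine le_of_forall_pos_le_add fun η hη => ?_
    have := hmain (η / φ x) (div_pos hη (hφ_pos x)) t ht x
    rw [div_mul_cancel₀ _ (hφ_pos x).ne'] at this
    linarith
  exact nonpos_of_mul_nonpos_right hexp_le (Real.exp_pos _)
end
end
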